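/- arXiv:2503.09558 — 7 statements merged into one kernel-verified Lean document; each statement's English description precedes it below -/
import Mathlib

section
/- Weighted matrix-tree theorem for the expanded vertex Laplacian. Let G be a connected graph with positive Schwinger parameters. Then det 𝕄 = ∑_{T spanning tree} ∏_{e_i ∉ T} a_i, and det 𝕄 = (∏_{i=1}^m a_i) · det(𝕀ᵀ D⁻¹ 𝕀). -/
open Matrix BigOperators

namespace GraphForms

/-- Vertices `x` and `y` are connected using only edges in `T` (in either direction). -/
def Conn (m n : ℕ) (s t : Fin m → Fin n) (T : Set (Fin m)) (x y : Fin n) : Prop :=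
  Relation.ReflTransGen
    (fun a b => ∃ e ∈ T, (s e = a ∧ t e = b) ∨ (s e = b ∧ t e = a)) x y

/-- The graph is connected. -/
def IsConnectedGraph (m n : ℕ) (s t : Fin m → Fin n) : Prop :=
  ∀ x y, Conn m n s t Set.univ x y

/-- `T ⊆ E` is a spanning tree: it has `n - 1` edges and connects all vertices. -/
def IsSpanningTree (m n : ℕ) (s t : Fin m → Fin n) (T : Finset (Fin m)) : Prop :=
  T.card = n - 1 ∧ ∀ x y, Conn m n s t ↑T x y

/-- The reduced vertex incidence matrix `𝕀` (the distinguished vertex is the last one). -/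
def inc (R : Type*) [Ring R] (m n' : ℕ) (s t : Fin m → Fin (n' + 1)) :
    Matrix (Fin m) (Fin n') R :=
  Matrix.of fun e j =>
    (if t e = Fin.castSucc j then (1 : R) else 0) -
      (if s e = Fin.castSucc j then (1 : R) else 0)

/-- `C` is a cycle incidence matrix: its columns lie in, and form a `ℤ`-basis of,
the lattice `{x : ℤ^E | 𝕀ᵀ x = 0}`. -/
def IsCycleMatrix (m n' ℓ : ℕ) (s t : Fin m → Fin (n' + 1))
    (C : Matrix (Fin m) (Fin ℓ) ℤ) : Prop :=
  (inc ℤ m n' s t)ᵀ * C = 0 ∧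
    ∀ x : Fin m → ℤ, (inc ℤ m n' s t)ᵀ.mulVec x = 0 →
      ∃! c : Fin ℓ → ℤ, C.mulVec c = x

/-- The concatenation `[X|Y]` of the columns of `X` and of `Y`, a square matrix. -/
def concat {R : Type*} {m ℓ c : ℕ} (h : ℓ + c = m) (X : Matrix (Fin m) (Fin ℓ) R)
    (Y : Matrix (Fin m) (Fin c) R) : Matrix (Fin m) (Fin m) R :=
  Matrix.of fun i j => Sum.elim (X i) (Y i) (finSumFinEquiv.symm (Fin.cast h.symm j))

/-- The row submatrix `X[S]` (rows of `S` taken in increasing order);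
junk value `0` if `S.card ≠ k`. -/
noncomputable def rowSub {R : Type*} [Zero R] {m c : ℕ} (X : Matrix (Fin m) (Fin c) R)
    (S : Finset (Fin m)) (k : ℕ) : Matrix (Fin k) (Fin c) R :=
  if h : S.card = k then Matrix.of fun i j => X ((S.orderIsoOfFin h) i : Fin m) j else 0

/-- The expanded vertex Laplacian `𝕄`, rows/columns indexed by edges and then vertices. -/
def MM (m n' : ℕ) (s t : Fin m → Fin (n' + 1)) (a : Fin m → ℝ) :
    Matrix (Fin (m + n')) (Fin (m + n')) ℝ :=
  Matrix.of fun i j =>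
    Matrix.fromBlocks (Matrix.diagonal a) (inc ℝ m n' s t) (-(inc ℝ m n' s t)ᵀ) 0
      (finSumFinEquiv.symm i) (finSumFinEquiv.symm j)

/-- The Symanzik polynomial `ψ_G = det 𝕄`. -/
noncomputable def psi (m n' : ℕ) (s t : Fin m → Fin (n' + 1)) (a : Fin m → ℝ) : ℝ :=
  (MM m n' s t a).det

/-- The Dodgson polynomial `ψ^{A,B}`: delete the rows in `A` and the columns in `B`
from `𝕄` (keeping the induced order) and take the determinant. -/
noncomputable def dodgson (m n' : ℕ) (s t : Fin m → Fin (n' + 1)) (a : Fin m → ℝ)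
    (A B : Finset (Fin (m + n'))) : ℝ :=
  if h : A.card = B.card then
    Matrix.det (Matrix.of fun i j : Fin (m + n' - A.card) =>
      MM m n' s t a
        ((Aᶜ.orderIsoOfFin (by simp [Finset.card_compl]) i : Fin (m + n')))
        ((Bᶜ.orderIsoOfFin (by simp [Finset.card_compl, h]) j : Fin (m + n'))))
  else 0

/-- Index of the edge `i` among the rows/columns of `𝕄`. -/
def edgeIdx (m n' : ℕ) (i : Fin m) : Fin (m + n') := Fin.castAdd n' i

/-- Index of the vertex `j` among the rows/columns of `𝕄`. -/
def vtxIdx (m n' : ℕ) (j : Fin n') : Fin (m + n') := Fin.natAdd m j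

/-- The edge Dodgson polynomial `ψ^{e_i,e_j}`. -/
noncomputable def dodgE (m n' : ℕ) (s t : Fin m → Fin (n' + 1)) (a : Fin m → ℝ)
    (i j : Fin m) : ℝ :=
  dodgson m n' s t a {edgeIdx m n' i} {edgeIdx m n' j}

/-- The vertex Dodgson polynomial `ψ^{v_i,v_j}`. -/
noncomputable def dodgV (m n' : ℕ) (s t : Fin m → Fin (n' + 1)) (a : Fin m → ℝ)
    (i j : Fin n') : ℝ :=
  dodgson m n' s t a {vtxIdx m n' i} {vtxIdx m n' j}

/-- The vertex Laplacian `L = 𝕀ᵀ D⁻¹ 𝕀`. -/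
noncomputable def vertexLap (m n' : ℕ) (s t : Fin m → Fin (n' + 1)) (a : Fin m → ℝ) :
    Matrix (Fin n') (Fin n') ℝ :=
  (inc ℝ m n' s t)ᵀ * Matrix.diagonal (fun i => (a i)⁻¹) * inc ℝ m n' s t

/-- The cycle Laplacian `Λ = 𝒞ᵀ D 𝒞`. -/
def cycleLap {m ℓ : ℕ} (a : Fin m → ℝ) (C : Matrix (Fin m) (Fin ℓ) ℤ) :
    Matrix (Fin ℓ) (Fin ℓ) ℝ :=
  (C.map (Int.cast : ℤ → ℝ))ᵀ * Matrix.diagonal a * C.map (Int.cast : ℤ → ℝ)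

/-- The degree-one generators `θ_i` of the exterior algebra `Ω`. -/
noncomputable def θ (m : ℕ) (i : Fin m) : ExteriorAlgebra ℝ (Fin m → ℝ) :=
  ExteriorAlgebra.ι ℝ (Pi.single i 1)

/-- The Pfaffian of a `2k × 2k` matrix with entries in the exterior algebra. -/
noncomputable def pfaffian {m N k : ℕ} (hk : N = 2 * k)
    (X : Matrix (Fin N) (Fin N) (ExteriorAlgebra ℝ (Fin m → ℝ))) :
    ExteriorAlgebra ℝ (Fin m → ℝ) :=
  ((2 ^ k * (Nat.factorial k : ℝ))⁻¹) •
    ∑ σ : Equiv.Perm (Fin N), (((Equiv.Perm.sign σ : ℤ) : ℝ)) •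
      (List.ofFn fun i : Fin k =>
        X (σ (Fin.cast hk.symm ⟨2 * i.1, by have := i.2; omega⟩))
          (σ (Fin.cast hk.symm ⟨2 * i.1 + 1, by have := i.2; omega⟩))).prod

/-- `dΛ = 𝒞ᵀ Θ 𝒞`, with `Θ = diag(θ_1, ..., θ_m)`, in the exterior algebra. -/
noncomputable def dLam {m ℓ : ℕ} (C : Matrix (Fin m) (Fin ℓ) ℤ) :
    Matrix (Fin ℓ) (Fin ℓ) (ExteriorAlgebra ℝ (Fin m → ℝ)) :=
  (C.map fun z => algebraMap ℝ (ExteriorAlgebra ℝ (Fin m → ℝ)) (z : ℝ))ᵀ *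
    Matrix.diagonal (θ m) *
    C.map fun z => algebraMap ℝ (ExteriorAlgebra ℝ (Fin m → ℝ)) (z : ℝ)

/-- The Pfaffian form `φ_G = (−2π)^{−ℓ/2} Pf(dΛ Λ⁻¹ dΛ) / √ψ_G`. -/
noncomputable def phiForm (m n' ℓ k : ℕ) (hk : ℓ = 2 * k)
    (s t : Fin m → Fin (n' + 1)) (a : Fin m → ℝ) (C : Matrix (Fin m) (Fin ℓ) ℤ) :
    ExteriorAlgebra ℝ (Fin m → ℝ) :=
  ((((-2) * Real.pi) ^ k)⁻¹ * (Real.sqrt (psi m n' s t a))⁻¹) •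
    pfaffian hk
      (dLam C * ((cycleLap a C)⁻¹).map (algebraMap ℝ (ExteriorAlgebra ℝ (Fin m → ℝ))) *
        dLam C)

open Classical in
/-- Sum of `F T` over all spanning trees `T` of the graph. -/
noncomputable def treeSum {β : Type*} [AddCommMonoid β] (m n' : ℕ)
    (s t : Fin m → Fin (n' + 1)) (F : Finset (Fin m) → β) : β :=
  ∑ T ∈ Finset.univ.filter (fun T : Finset (Fin m) => IsSpanningTree m (n' + 1) s t T), F T

open Classical in
/-- The number of spanning trees of the graph. -/
noncomputable def treeCount (m n' : ℕ) (s t : Fin m → Fin (n' + 1)) : ℕ :=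
  (Finset.univ.filter (fun T : Finset (Fin m) => IsSpanningTree m (n' + 1) s t T)).card

/-- The summand of `α_G` corresponding to a spanning tree `T`. -/
noncomputable def alphaTerm {m n' ℓ k : ℕ} (hk : ℓ = 2 * k)
    (s t : Fin m → Fin (n' + 1)) (a : Fin m → ℝ) (T : Finset (Fin m)) :
    ExteriorAlgebra ℝ (Fin m → ℝ) :=
  if h : Tᶜ.card = ℓ then
    ((rowSub (inc ℝ m n' s t) T n').det *
        ∑ σ : Equiv.Perm (Fin ℓ), ∏ i : Fin k,
          dodgE m n' s t a
            ((Tᶜ.orderIsoOfFin h) (σ (Fin.cast hk.symm ⟨2 * i.1, by have := i.2; omega⟩)) : Fin m)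
            ((Tᶜ.orderIsoOfFin h) (σ (Fin.cast hk.symm ⟨2 * i.1 + 1, by have := i.2; omega⟩)) : Fin m)) •
      (List.ofFn fun j : Fin ℓ => θ m ((Tᶜ.orderIsoOfFin h) j : Fin m)).prod
  else 0

/-- The topological form `α_G`. -/
noncomputable def alphaForm (m n' ℓ k : ℕ) (hk : ℓ = 2 * k)
    (s t : Fin m → Fin (n' + 1)) (a : Fin m → ℝ) :
    ExteriorAlgebra ℝ (Fin m → ℝ) :=
  ((Real.pi ^ k * 4 ^ ℓ * (Nat.factorial k : ℝ) *
      psi m n' s t a ^ (((ℓ : ℝ) + 1) / 2))⁻¹) •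
    treeSum m n' s t (alphaTerm hk s t a)

/-- A walk in the graph, with signed edge traversals. -/
structure GWalk (m n : ℕ) (s t : Fin m → Fin n) (k : ℕ) where
  g : Fin k → Fin m
  ε : Fin k → ℤ
  u : Fin (k + 1) → Fin n
  hε : ∀ i, ε i = 1 ∨ ε i = -1
  hstep : ∀ i : Fin k,
    (ε i = 1 → s (g i) = u i.castSucc ∧ t (g i) = u i.succ) ∧
    (ε i = -1 → s (g i) = u i.succ ∧ t (g i) = u i.castSucc)

/-- The signed incidence vector of a walk. -/
def GWalk.vec {m n k : ℕ} {s t : Fin m → Fin n} (W : GWalk m n s t k) : Fin m → ℤ :=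
  fun e => ∑ i : Fin k, if W.g i = e then W.ε i else 0

/-- The lift of a vector along the subdivision of the edge `k` into two edges. -/
def liftVec {m : ℕ} (k : Fin m) (x : Fin m → ℤ) : Fin (m + 1) → ℤ :=
  fun i => if _ : i.1 ≤ k.1 then x ⟨i.1, by have := k.2; omega⟩
    else x ⟨i.1 - 1, by have := i.2; omega⟩

end GraphForms

/-- Expansion of `det (A * B)` over all choices of one row of `B` per row of `A`. -/
theorem Matrix.det_mul_eq_sum_prod_mul_det_submatrix {ι κ R : Type*} [Fintype ι] [DecidableEq ι]
    [Fintype κ] [CommRing R] (A : Matrix ι κ R) (B : Matrix κ ι R) :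
    (A * B).det = ∑ f : ι → κ, (∏ i, A i (f i)) * (B.submatrix f id).det := by
  classical
  have h : A * B = fun i => ∑ k, A i k • B k := by
    ext i j
    simp [Matrix.mul_apply]
  rw [h]
  change (Matrix.detRowAlternating (R := R) (n := ι)).toMultilinearMap _ = _
  rw [MultilinearMap.map_sum]
  refine Finset.sum_congr rfl fun f _ => ?_
  rw [MultilinearMap.map_smul_univ]
  rfl

/-- The part of the expansion of `det (A * B)` supported on a fixed set of rows of `B`. -/
theorem Matrix.sum_image_eq_prod_mul_det_submatrix {κ R : Type*} {n : ℕ} [Fintype κ]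
    [LinearOrder κ] [CommRing R] (A : Matrix (Fin n) κ R) (B : Matrix κ (Fin n) R)
    (S : Finset κ) (h : S.card = n) :
    ∑ f : Fin n → κ with Finset.univ.image f = S, (∏ i, A i (f i)) * (B.submatrix f id).det =
      (A.submatrix id (S.orderEmbOfFin h)).det * (B.submatrix (S.orderEmbOfFin h) id).det := by
  have himage : Finset.univ.image (S.orderEmbOfFin h) = S := by
    simp
  rw [← Matrix.det_transpose (A.submatrix _ _), Matrix.det_apply', Finset.sum_mul]
  symm
  refine Finset.sum_bij (fun σ _ => S.orderEmbOfFin h ∘ σ) ?_ ?_ ?_ ?_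
  · intro σ _
    simp only [Finset.mem_filter, Finset.mem_univ, true_and]
    rw [← Finset.image_image, Finset.image_univ_of_surjective σ.surjective, himage]
  · intro σ _ τ _ hστ
    ext i
    exact congrArg Fin.val ((S.orderEmbOfFin h).injective (congrFun hστ i))
  · intro f hf
    simp only [Finset.mem_filter, Finset.mem_univ, true_and] at hf
    have hmem : ∀ i, ∃ j, S.orderEmbOfFin h j = f i := fun i => by
      have : f i ∈ Finset.univ.image (S.orderEmbOfFin h) := by
        rw [himage, ← hf]
        exact Finset.mem_image_of_mem f (Finset.mem_univ i)
      simpa only [Finset.mem_image, Finset.mem_univ, true_and] using this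
    choose σ hσ using hmem
    have hinj : Function.Injective f := by
      have : (Finset.univ.image f).card = (Finset.univ : Finset (Fin n)).card := by
        rw [hf, h, Finset.card_univ, Fintype.card_fin]
      exact Set.injOn_univ.1 (by simpa using Finset.card_image_iff.1 this)
    have hσinj : Function.Injective σ := fun i j hij => hinj (by rw [← hσ i, ← hσ j, hij])
    exact ⟨Equiv.ofBijective σ (Finite.injective_iff_bijective.1 hσinj), Finset.mem_univ _,
      funext hσ⟩
  · intro σ _
    have : B.submatrix (S.orderEmbOfFin h ∘ σ) id =
        (B.submatrix (S.orderEmbOfFin h) id).submatrix σ id := rfl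
    rw [this, Matrix.det_permute]
    simp only [Matrix.transpose_apply, Matrix.submatrix_apply, id, Function.comp_apply]
    ring

/-- The **Cauchy–Binet formula**. -/
theorem Matrix.det_mul_eq_sum_det_mul_det {κ R : Type*} {n : ℕ} [Fintype κ]
    [LinearOrder κ] [CommRing R] (A : Matrix (Fin n) κ R) (B : Matrix κ (Fin n) R) :
    (A * B).det = ∑ S : Finset κ, if h : S.card = n then
      (A.submatrix id (S.orderEmbOfFin h)).det * (B.submatrix (S.orderEmbOfFin h) id).det
      else 0 := by
  rw [Matrix.det_mul_eq_sum_prod_mul_det_submatrix,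
    ← Finset.sum_fiberwise (s := Finset.univ) (g := fun f : Fin n → κ => Finset.univ.image f)]
  refine Finset.sum_congr rfl fun S _ => ?_
  split_ifs with h
  · exact Matrix.sum_image_eq_prod_mul_det_submatrix A B S h
  · refine Finset.sum_eq_zero fun f hf => ?_
    simp only [Finset.mem_filter, Finset.mem_univ, true_and] at hf
    have hninj : ¬ Function.Injective f := fun hinj => h <| by
      rw [← hf, Finset.card_image_of_injective _ hinj, Finset.card_univ, Fintype.card_fin]
    obtain ⟨i, j, hij, hne⟩ := Function.not_injective_iff.1 hninj
    rw [Matrix.det_zero_of_row_eq hne (by ext k; simp [hij]), mul_zero]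

namespace GraphForms

theorem Conn.symm {m n : ℕ} {s t : Fin m → Fin n} {T : Set (Fin m)} {x y : Fin n}
    (h : Conn m n s t T x y) : Conn m n s t T y x :=
  have : Std.Symm fun a b => ∃ e ∈ T, (s e = a ∧ t e = b) ∨ (s e = b ∧ t e = a) :=
    ⟨fun _ _ ⟨e, he, h⟩ => ⟨e, he, h.symm⟩⟩
  Relation.ReflTransGen.stdSymm.symm _ _ h

/-- The standard basis vector of a vertex, with the distinguished vertex sent to `0`. -/
def vertexVec (n' : ℕ) (v : Fin (n' + 1)) : Fin n' → ℤ :=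
  fun j => if v = Fin.castSucc j then 1 else 0

theorem inc_eq_vertexVec_sub (m n' : ℕ) (s t : Fin m → Fin (n' + 1)) (e : Fin m) :
    inc ℤ m n' s t e = vertexVec n' (t e) - vertexVec n' (s e) := rfl

theorem Conn.vertexVec_sub_mem_span {m n' : ℕ} {s t : Fin m → Fin (n' + 1)} {T : Set (Fin m)}
    {x y : Fin (n' + 1)} (h : Conn m (n' + 1) s t T x y) :
    vertexVec n' y - vertexVec n' x ∈ Submodule.span ℤ (inc ℤ m n' s t '' T) := by
  induction h with
  | refl => simp
  | @tail b c _ hbc ih =>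
    obtain ⟨e, he, h⟩ := hbc
    have hmem : inc ℤ m n' s t e ∈ Submodule.span ℤ (inc ℤ m n' s t '' T) :=
      Submodule.subset_span ⟨e, he, rfl⟩
    rw [inc_eq_vertexVec_sub] at hmem
    rcases h with ⟨rfl, rfl⟩ | ⟨rfl, rfl⟩
    · simpa using add_mem ih hmem
    · simpa [sub_sub_sub_cancel_left] using sub_mem ih hmem

/-- The rows of a connecting edge set span the whole lattice. -/
theorem span_inc_eq_top {m n' : ℕ} {s t : Fin m → Fin (n' + 1)} {T : Set (Fin m)}
    (h : ∀ x y, Conn m (n' + 1) s t T x y) :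
    Submodule.span ℤ (inc ℤ m n' s t '' T) = ⊤ := by
  rw [eq_top_iff, ← (Pi.basisFun ℤ (Fin n')).span_eq, Submodule.span_le]
  rintro _ ⟨j, rfl⟩
  have hj := (h (Fin.last n') (Fin.castSucc j)).vertexVec_sub_mem_span
  have hbasis : Pi.basisFun ℤ (Fin n') j =
      vertexVec n' j.castSucc - vertexVec n' (Fin.last n') := by
    ext k
    have : Fin.last n' ≠ k.castSucc := (Fin.castSucc_lt_last k).ne'
    simp [vertexVec, this, Pi.single_apply, eq_comm]
  rwa [SetLike.mem_coe, hbasis]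

theorem det_inc_submatrix_sq_eq_one {m n' : ℕ} {s t : Fin m → Fin (n' + 1)}
    {g : Fin n' → Fin m} (h : ∀ x y, Conn m (n' + 1) s t (Set.range g) x y) :
    ((inc ℤ m n' s t).submatrix g id).det ^ 2 = 1 := by
  have hspan := span_inc_eq_top h
  rw [← Set.range_comp (inc ℤ m n' s t) g] at hspan
  have hsurj : Function.Surjective ((inc ℤ m n' s t).submatrix g id).vecMul := by
    intro x
    have hx : x ∈ Submodule.span ℤ (Set.range (inc ℤ m n' s t ∘ g)) := by simp [hspan]
    obtain ⟨c, hc⟩ := (Submodule.mem_span_range_iff_exists_fun ℤ).1 hx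
    refine ⟨c, ?_⟩
    exact (Matrix.vecMul_eq_sum _ _).trans hc
  have hunit := (Matrix.isUnit_iff_isUnit_det _).1 (Matrix.vecMul_surjective_iff_isUnit.1 hsurj)
  rcases Int.isUnit_iff.1 hunit with h | h <;> simp [h]

theorem det_inc_submatrix_eq_zero {m n' : ℕ} {s t : Fin m → Fin (n' + 1)}
    {g : Fin n' → Fin m} (h : ¬ ∀ x y, Conn m (n' + 1) s t (Set.range g) x y) :
    ((inc ℤ m n' s t).submatrix g id).det = 0 := by
  classical
  obtain ⟨x, hx⟩ : ∃ x, ¬ Conn m (n' + 1) s t (Set.range g) x (Fin.last n') := by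
    by_contra! hall
    exact h fun x y => (hall x).trans (hall y).symm
  let c : Fin (n' + 1) → ℤ := fun v => if Conn m (n' + 1) s t (Set.range g) x v then 1 else 0
  have hlast : c (Fin.last n') = 0 := if_neg hx
  have hxne : x ≠ Fin.last n' := by
    rintro rfl
    exact hx Relation.ReflTransGen.refl
  have hsum (v : Fin (n' + 1)) : vertexVec n' v ⬝ᵥ (fun j => c j.castSucc) = c v := by
    induction v using Fin.lastCases with
    | last =>
      have (k : Fin n') : Fin.last n' ≠ k.castSucc := (Fin.castSucc_lt_last k).ne'
      simp [vertexVec, dotProduct, this, hlast]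
    | cast j => simp [vertexVec, dotProduct]
  refine Matrix.exists_mulVec_eq_zero_iff.1 ⟨fun j => c j.castSucc, fun hzero => ?_, ?_⟩
  · have := congrFun hzero (x.castPred hxne)
    simp [c, show Conn m (n' + 1) s t (Set.range g) x x from Relation.ReflTransGen.refl] at this
  · ext i
    change inc ℤ m n' s t (g i) ⬝ᵥ _ = 0
    rw [inc_eq_vertexVec_sub, sub_dotProduct, hsum, hsum, sub_eq_zero]
    have hiff : Conn m (n' + 1) s t (Set.range g) x (t (g i)) ↔
        Conn m (n' + 1) s t (Set.range g) x (s (g i)) :=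
      ⟨fun hc => hc.tail ⟨g i, ⟨i, rfl⟩, Or.inr ⟨rfl, rfl⟩⟩,
        fun hc => hc.tail ⟨g i, ⟨i, rfl⟩, Or.inl ⟨rfl, rfl⟩⟩⟩
    simp only [c, hiff]

open Classical in
theorem det_inc_submatrix_sq {m n' : ℕ} {s t : Fin m → Fin (n' + 1)} (S : Finset (Fin m))
    (h : S.card = n') :
    ((inc ℝ m n' s t).submatrix (S.orderEmbOfFin h) id).det ^ 2 =
      if IsSpanningTree m (n' + 1) s t S then 1 else 0 := by
  have hcast : (inc ℝ m n' s t).submatrix (S.orderEmbOfFin h) id =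
      ((inc ℤ m n' s t).submatrix (S.orderEmbOfFin h) id).map (Int.castRingHom ℝ) := by
    ext i j
    simp [inc]
  have hrange : (S : Set (Fin m)) = Set.range (S.orderEmbOfFin h) :=
    (Finset.range_orderEmbOfFin S h).symm
  rw [hcast, ← RingHom.mapMatrix_apply, ← RingHom.map_det, ← map_pow]
  split_ifs with hS
  · rw [det_inc_submatrix_sq_eq_one (hrange ▸ hS.2), map_one]
  · rw [det_inc_submatrix_eq_zero fun hall => hS ⟨by simpa using h, hrange ▸ hall⟩]
    simp

/-- The weighted matrix-tree theorem for the vertex Laplacian. -/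
theorem det_vertexLap (m n' : ℕ) (s t : Fin m → Fin (n' + 1)) (a : Fin m → ℝ) :
    (vertexLap m n' s t a).det = treeSum m n' s t (fun T => ∏ e ∈ T, (a e)⁻¹) := by
  classical
  rw [vertexLap, Matrix.det_mul_eq_sum_det_mul_det, treeSum, Finset.sum_filter]
  refine Finset.sum_congr rfl fun S _ => ?_
  by_cases h : S.card = n'
  · have hsub : ((inc ℝ m n' s t)ᵀ * Matrix.diagonal (fun i => (a i)⁻¹)).submatrix id
        (S.orderEmbOfFin h) = ((inc ℝ m n' s t).submatrix (S.orderEmbOfFin h) id)ᵀ *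
          Matrix.diagonal (fun i => (a (S.orderEmbOfFin h i))⁻¹) := by
      ext i j
      simp [Matrix.mul_diagonal]
    have hprod : ∏ i, (a (S.orderEmbOfFin h i))⁻¹ = ∏ e ∈ S, (a e)⁻¹ := by
      conv_rhs => rw [← Finset.map_orderEmbOfFin_univ S h, Finset.prod_map]
      rfl
    rw [dif_pos h, hsub, Matrix.det_mul, Matrix.det_transpose, Matrix.det_diagonal, hprod,
      mul_right_comm, ← sq, det_inc_submatrix_sq, ite_mul, one_mul, zero_mul]
  · rw [dif_neg h, if_neg fun hS => h (by simpa using hS.1)]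

theorem det_MM (m n' : ℕ) (s t : Fin m → Fin (n' + 1)) (a : Fin m → ℝ) (ha : ∀ i, a i ≠ 0) :
    (MM m n' s t a).det = (∏ i, a i) * (vertexLap m n' s t a).det := by
  let : Invertible (Matrix.diagonal a) :=
    ⟨Matrix.diagonal fun i => (a i)⁻¹, by simp [ha], by simp [ha]⟩
  have hinv : ⅟(Matrix.diagonal a) = Matrix.diagonal fun i => (a i)⁻¹ := rfl
  change ((Matrix.fromBlocks (Matrix.diagonal a) (inc ℝ m n' s t) (-(inc ℝ m n' s t)ᵀ)
    0).submatrix finSumFinEquiv.symm finSumFinEquiv.symm).det = _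
  rw [Matrix.det_submatrix_equiv_self, Matrix.det_fromBlocks₁₁, Matrix.det_diagonal, hinv,
    vertexLap]
  simp [Matrix.neg_mul]

/-- **Weighted matrix-tree theorem for the expanded vertex Laplacian.** -/
theorem matrix_tree_expanded_laplacian (m n' : ℕ) (s t : Fin m → Fin (n' + 1))
    (hconn : IsConnectedGraph m (n' + 1) s t)
    (a : Fin m → ℝ) (ha : ∀ i, 0 < a i) :
    (MM m n' s t a).det = treeSum m n' s t (fun T => ∏ e ∈ Tᶜ, a e) ∧
    (MM m n' s t a).det = (∏ i, a i) * (vertexLap m n' s t a).det := by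
  have hdet := det_MM m n' s t a fun i => (ha i).ne'
  refine ⟨?_, hdet⟩
  rw [hdet, det_vertexLap, treeSum, treeSum, Finset.mul_sum]
  refine Finset.sum_congr rfl fun T _ => ?_
  have hT : ∏ e ∈ T, a e ≠ 0 := Finset.prod_ne_zero_iff.2 fun e _ => (ha e).ne'
  rw [Finset.prod_inv_distrib, ← Finset.prod_mul_prod_compl T a]
  field_simp

end GraphForms
end

section
/- Complementary projector identity relating the two Laplacians. Let G be a connected graph with positive Schwinger parameters and 𝒞 a cycle incidence matrix of G. Then L = 𝕀ᵀ D⁻¹ 𝕀 and Λ = 𝒞ᵀ D 𝒞 are invertible and D − 𝕀 L⁻¹ 𝕀ᵀ = D 𝒞 Λ⁻¹ 𝒞ᵀ D. -/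
open Matrix BigOperators

namespace GraphForms

theorem det_transpose_mul_diagonal_mul_ne_zero {R ι κ : Type*} [CommRing R] [LinearOrder R]
    [IsStrictOrderedRing R] [Fintype ι] [DecidableEq ι] [Fintype κ] [DecidableEq κ]
    {d : ι → R} (hd : ∀ i, 0 < d i) {X : Matrix ι κ R} (hX : ∀ v, X *ᵥ v = 0 → v = 0) :
    (Xᵀ * diagonal d * X).det ≠ 0 := by
  intro h
  obtain ⟨v, hv, hv0⟩ := exists_mulVec_eq_zero_iff.mpr h
  refine hv (hX v (funext fun i => ?_))
  have hq : ∑ i, (X *ᵥ v) i * (d i * (X *ᵥ v) i) = 0 := by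
    have h0 : v ⬝ᵥ ((Xᵀ * diagonal d * X) *ᵥ v) = 0 := by rw [hv0, dotProduct_zero]
    rw [Matrix.mul_assoc, ← mulVec_mulVec, dotProduct_mulVec, vecMul_transpose,
      ← mulVec_mulVec] at h0
    simpa only [dotProduct, mulVec_diagonal] using h0
  have hnonneg : ∀ j ∈ Finset.univ, 0 ≤ (X *ᵥ v) j * (d j * (X *ᵥ v) j) := fun j _ => by
    rw [mul_left_comm]
    exact mul_nonneg (hd j).le (mul_self_nonneg _)
  simpa [(hd i).ne'] using (Finset.sum_eq_zero_iff_of_nonneg hnonneg).mp hq i (Finset.mem_univ i)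

theorem inc_mulVec_apply (R : Type*) [Ring R] {m n' : ℕ} (s t : Fin m → Fin (n' + 1))
    (v : Fin n' → R) (e : Fin m) :
    (inc R m n' s t *ᵥ v) e =
      Fin.snoc (α := fun _ => R) v 0 (t e) - Fin.snoc (α := fun _ => R) v 0 (s e) := by
  have hsnoc (x : Fin (n' + 1)) :
      ∑ j, (if x = Fin.castSucc j then (1 : R) else 0) * v j =
        Fin.snoc (α := fun _ => R) v 0 x := by
    induction x using Fin.lastCases with
    | last => simp [(Fin.castSucc_ne_last _).symm]
    | cast i => simp
  simp only [mulVec, dotProduct, inc, of_apply, sub_mul, Finset.sum_sub_distrib, hsnoc]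

theorem eq_zero_of_inc_mulVec_eq_zero {R : Type*} [Ring R] {m n' : ℕ}
    {s t : Fin m → Fin (n' + 1)} (hconn : IsConnectedGraph m (n' + 1) s t) {v : Fin n' → R}
    (hv : inc R m n' s t *ᵥ v = 0) : v = 0 := by
  have hedge (e : Fin m) :
      Fin.snoc (α := fun _ => R) v 0 (t e) = Fin.snoc (α := fun _ => R) v 0 (s e) := by
    rw [← sub_eq_zero, ← inc_mulVec_apply, hv, Pi.zero_apply]
  have hconst (x y : Fin (n' + 1)) (h : Conn m (n' + 1) s t Set.univ x y) :
      Fin.snoc (α := fun _ => R) v 0 x = Fin.snoc (α := fun _ => R) v 0 y := by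
    induction h with
    | refl => rfl
    | tail _ h ih =>
      obtain ⟨e, -, ⟨rfl, rfl⟩ | ⟨rfl, rfl⟩⟩ := h
      · exact ih.trans (hedge e).symm
      · exact ih.trans (hedge e)
  funext j
  simpa using hconst j.castSucc (Fin.last n') (hconn _ _)

theorem eq_zero_of_map_intCast_mulVec_eq_zero {ι κ : Type*} [Fintype ι] [Fintype κ]
    {C : Matrix ι κ ℤ} (hC : ∀ c, C *ᵥ c = 0 → c = 0) {v : κ → ℝ}
    (hv : C.map (Int.cast : ℤ → ℝ) *ᵥ v = 0) : v = 0 := by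
  classical
  have hdet : (Cᵀ * C).det ≠ 0 := by
    simpa using det_transpose_mul_diagonal_mul_ne_zero (d := fun _ => 1)
      (fun _ => one_pos) hC
  have hmap : (C.map (Int.cast : ℤ → ℝ))ᵀ * C.map (Int.cast : ℤ → ℝ) =
      (Int.castRingHom ℝ).mapMatrix (Cᵀ * C) := by
    ext i j
    simp [mul_apply]
  refine eq_zero_of_mulVec_eq_zero
    (M := (C.map (Int.cast : ℤ → ℝ))ᵀ * C.map (Int.cast : ℤ → ℝ)) ?_ ?_
  · rw [hmap, ← RingHom.map_det]
    exact Int.cast_ne_zero.mpr hdet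
  · rw [← mulVec_mulVec, hv, mulVec_zero]

theorem IsCycleMatrix.eq_zero_of_mulVec_eq_zero {m n' ℓ : ℕ} {s t : Fin m → Fin (n' + 1)}
    {C : Matrix (Fin m) (Fin ℓ) ℤ} (hC : IsCycleMatrix m n' ℓ s t C) {c : Fin ℓ → ℤ}
    (hc : C *ᵥ c = 0) : c = 0 :=
  (hC.2 0 (mulVec_zero _)).unique hc (mulVec_zero _)

theorem IsCycleMatrix.transpose_inc_mul_map {m n' ℓ : ℕ} {s t : Fin m → Fin (n' + 1)}
    {C : Matrix (Fin m) (Fin ℓ) ℤ} (hC : IsCycleMatrix m n' ℓ s t C) :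
    (inc ℝ m n' s t)ᵀ * C.map (Int.cast : ℤ → ℝ) = 0 := by
  have hinc : inc ℝ m n' s t = (inc ℤ m n' s t).map (Int.castRingHom ℝ) := by
    ext e j
    simp [inc]
  have h := congrArg (fun M => M.map (Int.castRingHom ℝ)) hC.1
  rw [Matrix.map_mul, transpose_map, ← hinc] at h
  simpa using h

/-- If the columns of `B` and `C` are orthogonal and together as many as the rows, the weighted
projectors onto the two column spaces are complementary. -/
theorem diagonal_sub_mul_inv_mul_transpose_eq {K ι κ μ : Type*} [Field K] [Fintype ι]
    [DecidableEq ι] [Fintype κ] [DecidableEq κ] [Fintype μ] [DecidableEq μ]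
    (hcard : Fintype.card ι = Fintype.card κ + Fintype.card μ)
    {d : ι → K} (hd : ∀ i, d i ≠ 0) {B : Matrix ι κ K} {C : Matrix ι μ K} (hBC : Bᵀ * C = 0)
    (hL : IsUnit (Bᵀ * diagonal (fun i => (d i)⁻¹) * B).det)
    (hΛ : IsUnit (Cᵀ * diagonal d * C).det) :
    diagonal d - B * (Bᵀ * diagonal (fun i => (d i)⁻¹) * B)⁻¹ * Bᵀ =
      diagonal d * C * (Cᵀ * diagonal d * C)⁻¹ * Cᵀ * diagonal d := by
  have hdd : diagonal d * diagonal (fun i => (d i)⁻¹) = 1 := by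
    simp [diagonal_mul_diagonal, hd]
  have hCB : Cᵀ * B = 0 := by simpa using congrArg transpose hBC
  set D := diagonal d
  set D' := diagonal fun i => (d i)⁻¹
  set L := Bᵀ * D' * B with hLdef
  set Λ := Cᵀ * D * C with hΛdef
  have hblocks : fromRows (L⁻¹ * Bᵀ) (Λ⁻¹ * Cᵀ * D) * fromCols (D' * B) C = 1 := by
    rw [fromRows_mul_fromCols, ← fromBlocks_one]
    congr 1
    · rw [← nonsing_inv_mul L hL, hLdef]
      simp only [Matrix.mul_assoc]
    · rw [Matrix.mul_assoc, hBC, Matrix.mul_zero]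
    · rw [Matrix.mul_assoc, ← Matrix.mul_assoc D, hdd, Matrix.one_mul, Matrix.mul_assoc, hCB,
        Matrix.mul_zero]
    · rw [← nonsing_inv_mul Λ hΛ, hΛdef]
      simp only [Matrix.mul_assoc]
  replace hblocks := (mul_eq_one_comm_of_card_eq _ _ _ (by simp [hcard])).mp hblocks
  rw [fromCols_mul_fromRows] at hblocks
  rw [sub_eq_iff_eq_add']
  calc D = D * (D' * B * (L⁻¹ * Bᵀ) + C * (Λ⁻¹ * Cᵀ * D)) := by rw [hblocks, Matrix.mul_one]
    _ = (D * D') * (B * L⁻¹ * Bᵀ) + D * C * Λ⁻¹ * Cᵀ * D := by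
      simp only [Matrix.mul_add, Matrix.mul_assoc]
    _ = B * L⁻¹ * Bᵀ + D * C * Λ⁻¹ * Cᵀ * D := by rw [hdd, Matrix.one_mul]

/-- **Complementary projector identity relating the two Laplacians.** -/
theorem laplacian_projector_identity (m n' ℓ : ℕ) (s t : Fin m → Fin (n' + 1))
    (hconn : IsConnectedGraph m (n' + 1) s t) (hm : ℓ + n' = m)
    (a : Fin m → ℝ) (ha : ∀ i, 0 < a i)
    (C : Matrix (Fin m) (Fin ℓ) ℤ) (hC : IsCycleMatrix m n' ℓ s t C) :
    IsUnit (vertexLap m n' s t a).det ∧ IsUnit (cycleLap a C).det ∧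
    Matrix.diagonal a -
        inc ℝ m n' s t * (vertexLap m n' s t a)⁻¹ * (inc ℝ m n' s t)ᵀ =
      Matrix.diagonal a * C.map (Int.cast : ℤ → ℝ) * (cycleLap a C)⁻¹ *
        (C.map (Int.cast : ℤ → ℝ))ᵀ * Matrix.diagonal a := by
  have hL : IsUnit (vertexLap m n' s t a).det := isUnit_iff_ne_zero.mpr <|
    det_transpose_mul_diagonal_mul_ne_zero (fun i => inv_pos.mpr (ha i))
      fun _ => eq_zero_of_inc_mulVec_eq_zero hconn
  have hΛ : IsUnit (cycleLap a C).det := isUnit_iff_ne_zero.mpr <|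
    det_transpose_mul_diagonal_mul_ne_zero ha
      fun _ => eq_zero_of_map_intCast_mulVec_eq_zero fun _ => hC.eq_zero_of_mulVec_eq_zero
  exact ⟨hL, hΛ, diagonal_sub_mul_inv_mul_transpose_eq (by simp [← hm, add_comm])
    (fun i => (ha i).ne') hC.transpose_inc_mul_map hL hΛ⟩
end GraphForms
end

section
/- Square of the determinant of the concatenated matrix. Let G be a connected graph with positive Schwinger parameters and 𝒞 a cycle incidence matrix of G. Then det([𝒞 | D⁻¹𝕀])² = ψ_G² · ∏_{i=1}^m a_i^{−2}. -/
open Matrix BigOperators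

namespace GraphForms

/-- A path from `x` to `y` has a signed edge vector whose boundary is `y - x`. -/
theorem exists_mulVec_eq_of_conn {m n' : ℕ} {s t : Fin m → Fin (n' + 1)} {T : Set (Fin m)}
    {x y : Fin (n' + 1)} (h : Conn m (n' + 1) s t T x y) :
    ∃ p : Fin m → ℤ, (inc ℤ m n' s t)ᵀ *ᵥ p = fun j =>
      (if y = Fin.castSucc j then 1 else 0) - (if x = Fin.castSucc j then 1 else 0) := by
  induction h with
  | refl => exact ⟨0, by ext j; simp⟩
  | tail _ hstep ih =>
    obtain ⟨p, hp⟩ := ih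
    obtain ⟨e, -, ⟨rfl, rfl⟩ | ⟨rfl, rfl⟩⟩ := hstep
    · refine ⟨p + Pi.single e 1, ?_⟩
      rw [mulVec_add, hp, mulVec_single_one]
      ext j
      simp [inc]
    · refine ⟨p - Pi.single e 1, ?_⟩
      rw [mulVec_sub, hp, mulVec_single_one]
      ext j
      simp [inc]

/-- The transposed reduced incidence matrix of a connected graph has an integral right inverse. -/
theorem exists_inc_transpose_mul_eq_one {m n' : ℕ} {s t : Fin m → Fin (n' + 1)}
    (hconn : IsConnectedGraph m (n' + 1) s t) :
    ∃ P : Matrix (Fin m) (Fin n') ℤ, (inc ℤ m n' s t)ᵀ * P = 1 := by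
  choose p hp using fun j : Fin n' =>
    exists_mulVec_eq_of_conn (hconn (Fin.last n') (Fin.castSucc j))
  refine ⟨(of p)ᵀ, ?_⟩
  ext i j
  have h := congrFun (hp j) i
  simp only [(Fin.castSucc_lt_last i).ne', if_false, sub_zero, Fin.castSucc_inj] at h
  rw [one_apply, mul_apply]
  simpa only [mulVec, dotProduct, transpose_apply, of_apply, eq_comm (a := j)] using h

/-- The transposed incidence matrix extends to a unimodular matrix `[Q; 𝕀ᵀ]` with `Q * C = 1`. -/
theorem IsCycleMatrix.exists_unimodular {m n' ℓ : ℕ} {s t : Fin m → Fin (n' + 1)}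
    {C : Matrix (Fin m) (Fin ℓ) ℤ} (hC : IsCycleMatrix m n' ℓ s t C)
    (hconn : IsConnectedGraph m (n' + 1) s t) (e : Fin m ≃ Fin ℓ ⊕ Fin n') :
    ∃ Q : Matrix (Fin ℓ) (Fin m) ℤ, Q * C = 1 ∧
      ((fromRows Q (inc ℤ m n' s t)ᵀ).submatrix e id).det ^ 2 = 1 := by
  obtain ⟨P, hP⟩ := exists_inc_transpose_mul_eq_one hconn
  have hker : (inc ℤ m n' s t)ᵀ * (1 - P * (inc ℤ m n' s t)ᵀ) = 0 := by
    rw [Matrix.mul_sub, ← Matrix.mul_assoc, hP, Matrix.mul_one, Matrix.one_mul, sub_self]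
  choose q hq _ using fun i : Fin m =>
    hC.2 (fun k => (1 - P * (inc ℤ m n' s t)ᵀ : Matrix (Fin m) (Fin m) ℤ) k i) (by ext j; exact congrFun₂ hker j i)
  have hCQ : C * (of q)ᵀ = 1 - P * (inc ℤ m n' s t)ᵀ := by
    ext k i
    exact congrFun (hq i) k
  have hUV : fromCols C P * fromRows (of q)ᵀ (inc ℤ m n' s t)ᵀ = 1 := by
    rw [fromCols_mul_fromRows, hCQ, sub_add_cancel]
  have hVU := (mul_eq_one_comm_of_equiv e).mp hUV
  rw [fromRows_mul_fromCols, ← fromBlocks_one, fromBlocks_inj] at hVU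
  refine ⟨(of q)ᵀ, hVU.1, ?_⟩
  have hdet : ((fromCols C P).submatrix id e).det *
      ((fromRows (of q)ᵀ (inc ℤ m n' s t)ᵀ).submatrix e id).det = 1 := by
    rw [← det_mul, submatrix_mul_equiv, hUV, submatrix_id_id, det_one]
  exact Int.isUnit_sq (IsUnit.of_mul_eq_one_right _ hdet)

/-- The Schur complement formula for the Symanzik polynomial. -/
theorem psi_eq_prod_mul_det_vertexLap {m n' : ℕ} (s t : Fin m → Fin (n' + 1)) {a : Fin m → ℝ}
    (ha : ∀ i, a i ≠ 0) : psi m n' s t a = (∏ i, a i) * (vertexLap m n' s t a).det := by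
  have hinv : diagonal a * diagonal (fun i => (a i)⁻¹) = 1 := by
    simp [diagonal_mul_diagonal, ha]
  have hMM : MM m n' s t a =
      (fromBlocks (diagonal a) (inc ℝ m n' s t) (-(inc ℝ m n' s t)ᵀ) 0).submatrix
        finSumFinEquiv.symm finSumFinEquiv.symm := rfl
  let := invertibleOfRightInverse _ _ hinv
  rw [psi, hMM, det_submatrix_equiv_self, det_fromBlocks₁₁, det_diagonal,
    invOf_eq_right_inv hinv, vertexLap]
  simp

theorem inc_map_intCast (m n' : ℕ) (s t : Fin m → Fin (n' + 1)) :
    (inc ℤ m n' s t).map (Int.cast : ℤ → ℝ) = inc ℝ m n' s t := by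
  ext i j
  simp [inc]

/-- **Square of the determinant of the concatenated matrix.** -/
theorem det_concat_sq (m n' ℓ : ℕ) (s t : Fin m → Fin (n' + 1))
    (hconn : IsConnectedGraph m (n' + 1) s t) (hm : ℓ + n' = m)
    (a : Fin m → ℝ) (ha : ∀ i, 0 < a i)
    (C : Matrix (Fin m) (Fin ℓ) ℤ) (hC : IsCycleMatrix m n' ℓ s t C) :
    (concat hm (C.map (Int.cast : ℤ → ℝ))
        (Matrix.diagonal (fun i => (a i)⁻¹) * inc ℝ m n' s t)).det ^ 2 =
      psi m n' s t a ^ 2 * ∏ i, ((a i)⁻¹) ^ 2 := by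
  let e : Fin m ≃ Fin ℓ ⊕ Fin n' := (finCongr hm.symm).trans finSumFinEquiv.symm
  obtain ⟨Q, hQC, hQ⟩ := hC.exists_unimodular hconn e
  set W := fromCols (C.map (Int.cast : ℤ → ℝ)) (diagonal (fun i => (a i)⁻¹) * inc ℝ m n' s t)
  have hW : concat hm (C.map (Int.cast : ℤ → ℝ))
      (diagonal (fun i => (a i)⁻¹) * inc ℝ m n' s t) = W.submatrix id e := by
    ext i j
    simp only [concat, of_apply, submatrix_apply, id_eq]
    change Sum.elim _ _ (e j) = W i (e j)
    cases e j <;> rfl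
  set V := fromRows (Q.map (Int.cast : ℤ → ℝ)) (inc ℝ m n' s t)ᵀ
  have hV : (V.submatrix e id).det ^ 2 = 1 := by
    have hcast : V.submatrix e id =
        ((fromRows Q (inc ℤ m n' s t)ᵀ).submatrix e id).map (Int.cast : ℤ → ℝ) := by
      ext i j
      simp only [V, submatrix_apply, map_apply, ← inc_map_intCast]
      cases e i <;> rfl
    rw [hcast, ← Int.cast_det]
    exact_mod_cast hQ
  have hQC' : Q.map (Int.cast : ℤ → ℝ) * C.map (Int.cast : ℤ → ℝ) = 1 :=
    (Matrix.map_mul (f := Int.castRingHom ℝ)).symm.trans (by rw [hQC]; simp)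
  have hIC : (inc ℝ m n' s t)ᵀ * C.map (Int.cast : ℤ → ℝ) = 0 := by
    rw [← inc_map_intCast, ← transpose_map]
    exact (Matrix.map_mul (f := Int.castRingHom ℝ)).symm.trans (by rw [hC.1]; simp)
  have hVW : (V.submatrix e id).det * (W.submatrix id e).det = (vertexLap m n' s t a).det := by
    rw [← det_mul, ← submatrix_mul _ _ _ _ _ Function.bijective_id, det_submatrix_equiv_self,
      fromRows_mul_fromCols, hQC', hIC, det_fromBlocks_zero₂₁, det_one, one_mul, vertexLap,
      Matrix.mul_assoc]
  have hprod : (∏ i, a i) ≠ 0 := Finset.prod_ne_zero_iff.mpr fun i _ => (ha i).ne'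
  rw [hW, ← one_mul ((W.submatrix id e).det ^ 2), ← hV, ← mul_pow, hVW,
    psi_eq_prod_mul_det_vertexLap s t fun i => (ha i).ne', Finset.prod_pow, Finset.prod_inv_distrib]
  field_simp

end GraphForms
end

section
/- Concatenation with a left inverse of the weighted cycle matrix. Let G be a connected graph with positive Schwinger parameters, 𝒞 a cycle incidence matrix of G, and S any real m × ℓ matrix with Sᵀ D 𝒞 = 1_ℓ. Then det[S|D⁻¹𝕀] · det[𝒞|D⁻¹𝕀] = ψ_G · ∏_{i=1}^m a_i^{−2}. In particular det[S|D⁻¹𝕀] = ± ∏_{i=1}^m a_i^{−1}. -/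
open Matrix BigOperators

namespace GraphForms

/-- Pairing two concatenations through a square matrix gives a block matrix determinant. -/
theorem det_concat_mul_det_mul_det_concat {R : Type*} [CommRing R] {m ℓ c : ℕ} (h : ℓ + c = m)
    (W : Matrix (Fin m) (Fin m) R) (X X' : Matrix (Fin m) (Fin ℓ) R)
    (Y Y' : Matrix (Fin m) (Fin c) R) :
    (concat h X Y).det * W.det * (concat h X' Y').det =
      (Matrix.fromBlocks (Xᵀ * W * X') (Xᵀ * W * Y') (Yᵀ * W * X') (Yᵀ * W * Y')).det := by
  let e : Fin m ≃ Fin ℓ ⊕ Fin c := (finCongr h.symm).trans finSumFinEquiv.symm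
  have hc (X : Matrix (Fin m) (Fin ℓ) R) (Y : Matrix (Fin m) (Fin c) R) :
      concat h X Y = (Matrix.fromCols X Y).submatrix id e := by
    ext i j
    simp only [concat, Matrix.of_apply, Matrix.submatrix_apply, id]
    change _ = Matrix.fromCols X Y i (finSumFinEquiv.symm (Fin.cast h.symm j))
    rcases finSumFinEquiv.symm (Fin.cast h.symm j) with k | k <;> rfl
  rw [← Matrix.det_transpose (concat h X Y), ← Matrix.det_mul, ← Matrix.det_mul,
    ← Matrix.det_submatrix_equiv_self e]
  congr 1
  rw [hc, hc, Matrix.transpose_submatrix, Matrix.transpose_fromCols]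
  ext i j
  rw [Matrix.submatrix_apply, ← Matrix.fromRows_mul_fromCols, ← Matrix.fromRows_mul]
  rfl

/-- An integral `1`-chain whose boundary is the difference of two connected vertices. -/
theorem exists_transpose_inc_mulVec_eq {m n' : ℕ} {s t : Fin m → Fin (n' + 1)}
    {T : Set (Fin m)} {x y : Fin (n' + 1)} (h : Conn m (n' + 1) s t T x y) :
    ∃ b : Fin m → ℤ, (inc ℤ m n' s t)ᵀ *ᵥ b = fun j : Fin n' =>
      (if y = j.castSucc then 1 else 0) - (if x = j.castSucc then 1 else 0) := by
  induction h with
  | refl => exact ⟨0, by ext; simp⟩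
  | tail _ hstep ih =>
    obtain ⟨b, hb⟩ := ih
    obtain ⟨e, -, ⟨rfl, rfl⟩ | ⟨rfl, rfl⟩⟩ := hstep
    · refine ⟨b + Pi.single e 1, ?_⟩
      rw [Matrix.mulVec_add, hb]
      ext j
      simp [inc]
    · refine ⟨b - Pi.single e 1, ?_⟩
      rw [Matrix.mulVec_sub, hb]
      ext j
      simp [inc]

/-- The transposed reduced incidence matrix of a connected graph has an integral right inverse. -/
theorem IsConnectedGraph.exists_transpose_inc_mul_eq_one {m n' : ℕ}
    {s t : Fin m → Fin (n' + 1)} (h : IsConnectedGraph m (n' + 1) s t) :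
    ∃ B : Matrix (Fin m) (Fin n') ℤ, (inc ℤ m n' s t)ᵀ * B = 1 := by
  choose b hb using fun j : Fin n' =>
    exists_transpose_inc_mulVec_eq (h (Fin.last n') j.castSucc)
  refine ⟨Matrix.of fun i j => b j i, ?_⟩
  ext i j
  have := congrFun (hb j) i
  simp only [Fin.castSucc_inj, (Fin.castSucc_lt_last i).ne', if_false, sub_zero] at this
  simp only [Matrix.one_apply, eq_comm (a := i)]
  exact this

/-- Mapping entries commutes with concatenation. -/
theorem map_concat {R R' : Type*} {m ℓ c : ℕ} (h : ℓ + c = m) (f : R → R')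
    (X : Matrix (Fin m) (Fin ℓ) R) (Y : Matrix (Fin m) (Fin c) R) :
    (concat h X Y).map f = concat h (X.map f) (Y.map f) := by
  ext i j
  simp only [concat, Matrix.map_apply, Matrix.of_apply]
  rcases finSumFinEquiv.symm (Fin.cast h.symm j) with k | k <;> rfl

/-- A cycle matrix and a right inverse of the boundary map concatenate to a unimodular matrix. -/
theorem IsCycleMatrix.isUnit_det_concat {m n' ℓ : ℕ} {s t : Fin m → Fin (n' + 1)}
    {C : Matrix (Fin m) (Fin ℓ) ℤ} (hC : IsCycleMatrix m n' ℓ s t C) (hm : ℓ + n' = m)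
    {B : Matrix (Fin m) (Fin n') ℤ} (hB : (inc ℤ m n' s t)ᵀ * B = 1) :
    IsUnit (concat hm C B).det := by
  rw [← Matrix.isUnit_iff_isUnit_det, ← Matrix.mulVec_surjective_iff_isUnit]
  intro x
  obtain ⟨c, hc, -⟩ := hC.2 (x - B *ᵥ ((inc ℤ m n' s t)ᵀ *ᵥ x)) (by
    rw [Matrix.mulVec_sub, Matrix.mulVec_mulVec _ _ B, hB, Matrix.one_mulVec, sub_self])
  let e : Fin m ≃ Fin ℓ ⊕ Fin n' := (finCongr hm.symm).trans finSumFinEquiv.symm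
  refine ⟨fun j => Sum.elim c ((inc ℤ m n' s t)ᵀ *ᵥ x) (e j), ?_⟩
  ext i
  have hi := congrFun hc i
  simp only [Pi.sub_apply, eq_sub_iff_add_eq] at hi
  rw [← hi]
  simp only [Matrix.mulVec, dotProduct, concat, Matrix.of_apply]
  refine (e.sum_comp fun k =>
    Sum.elim (C i) (B i) k * Sum.elim c ((inc ℤ m n' s t)ᵀ *ᵥ x) k).trans ?_
  simp [Matrix.mulVec, dotProduct]

/-- **Concatenation with a left inverse of the weighted cycle matrix.** -/
theorem det_concat_left_inverse_cycle (m n' ℓ : ℕ) (s t : Fin m → Fin (n' + 1))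
    (hconn : IsConnectedGraph m (n' + 1) s t) (hm : ℓ + n' = m)
    (a : Fin m → ℝ) (ha : ∀ i, 0 < a i)
    (C : Matrix (Fin m) (Fin ℓ) ℤ) (hC : IsCycleMatrix m n' ℓ s t C)
    (S : Matrix (Fin m) (Fin ℓ) ℝ)
    (hS : Sᵀ * Matrix.diagonal a * C.map (Int.cast : ℤ → ℝ) = 1) :
    (concat hm S (Matrix.diagonal (fun i => (a i)⁻¹) * inc ℝ m n' s t)).det *
        (concat hm (C.map (Int.cast : ℤ → ℝ))
          (Matrix.diagonal (fun i => (a i)⁻¹) * inc ℝ m n' s t)).det =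
      psi m n' s t a * ∏ i, ((a i)⁻¹) ^ 2 ∧
    ((concat hm S (Matrix.diagonal (fun i => (a i)⁻¹) * inc ℝ m n' s t)).det =
        ∏ i, (a i)⁻¹ ∨
      (concat hm S (Matrix.diagonal (fun i => (a i)⁻¹) * inc ℝ m n' s t)).det =
        -∏ i, (a i)⁻¹) := by
  have ha' : ∀ i, a i ≠ 0 := fun i => (ha i).ne'
  have hprod : ∏ i, a i ≠ 0 := Finset.prod_ne_zero_iff.2 fun i _ => ha' i
  have hmap : inc ℝ m n' s t = (inc ℤ m n' s t).map (Int.castRingHom ℝ) := by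
    ext i j
    simp [inc]
  have hinv : Matrix.diagonal (fun i => (a i)⁻¹) * Matrix.diagonal a = 1 := by
    simp [Matrix.diagonal_mul_diagonal, ha']
  have hY : (Matrix.diagonal (fun i => (a i)⁻¹) * inc ℝ m n' s t)ᵀ * Matrix.diagonal a =
      (inc ℝ m n' s t)ᵀ := by
    rw [Matrix.transpose_mul, Matrix.diagonal_transpose, Matrix.mul_assoc, hinv, Matrix.mul_one]
  have hIC : (inc ℝ m n' s t)ᵀ * C.map (Int.cast : ℤ → ℝ) = 0 := by
    have := congrArg (fun M => M.map (Int.castRingHom ℝ)) hC.1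
    rw [Matrix.map_mul, Matrix.transpose_map, ← hmap] at this
    simpa using this
  constructor
  · have h := det_concat_mul_det_mul_det_concat hm (Matrix.diagonal a) S
      (C.map (Int.cast : ℤ → ℝ)) (Matrix.diagonal (fun i => (a i)⁻¹) * inc ℝ m n' s t)
      (Matrix.diagonal (fun i => (a i)⁻¹) * inc ℝ m n' s t)
    rw [hY, hIC, hS, Matrix.det_fromBlocks_zero₂₁, Matrix.det_one, one_mul,
      ← Matrix.mul_assoc _ _ (inc ℝ m n' s t), Matrix.det_diagonal] at h
    rw [psi_eq_prod_mul_det_vertexLap s t ha', vertexLap, ← h, Finset.prod_pow,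
      Finset.prod_inv_distrib]
    field_simp
  · obtain ⟨B, hB⟩ := hconn.exists_transpose_inc_mul_eq_one
    have hIB : (inc ℝ m n' s t)ᵀ * B.map (Int.cast : ℤ → ℝ) = 1 := by
      have := congrArg (fun M => M.map (Int.castRingHom ℝ)) hB
      rw [Matrix.map_mul, Matrix.transpose_map, ← hmap] at this
      simpa using this
    have h := det_concat_mul_det_mul_det_concat hm (Matrix.diagonal a) S
      (C.map (Int.cast : ℤ → ℝ)) (Matrix.diagonal (fun i => (a i)⁻¹) * inc ℝ m n' s t)
      (B.map (Int.cast : ℤ → ℝ))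
    have hdet : (concat hm (C.map (Int.cast : ℤ → ℝ)) (B.map (Int.cast : ℤ → ℝ))).det =
        ((concat hm C B).det : ℝ) := by
      rw [← map_concat, Int.cast_det]
    rw [hY, hIC, hIB, hS, Matrix.det_fromBlocks_zero₂₁, Matrix.det_one, Matrix.det_one, one_mul,
      Matrix.det_diagonal, hdet] at h
    rw [Finset.prod_inv_distrib]
    rcases Int.isUnit_iff.1 (hC.isUnit_det_concat hm hB) with hu | hu <;> rw [hu] at h
    · left
      apply eq_inv_of_mul_eq_one_left
      simpa using h
    · right
      rw [← neg_eq_iff_eq_neg]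
      apply eq_inv_of_mul_eq_one_left
      simpa using h

end GraphForms
end

section
/- Spanning tree count from concatenated determinants. Let G be a connected graph, 𝒞 a cycle incidence matrix of G, and R any real m × (n−1) matrix with Rᵀ 𝕀 = 1_{n−1}. Then det[𝒞|𝕀] = det[𝒞|R] · N, where N is the number of spanning trees of G, and det[𝒞|R] ∈ {+1, −1}. -/
open Matrix BigOperators

namespace GraphForms

/-- Concatenation of matrices as a reindexing of `Matrix.fromCols`. -/
theorem concat_eq_submatrix {A : Type*} {m ℓ c : ℕ} (h : ℓ + c = m)
    (X : Matrix (Fin m) (Fin ℓ) A) (Y : Matrix (Fin m) (Fin c) A) :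
    concat h X Y =
      (fromCols X Y).submatrix id ((finCongr h.symm).trans finSumFinEquiv.symm) := by
  ext i j
  simp only [concat, of_apply, submatrix_apply, id, Equiv.trans_apply, finCongr_apply]
  cases finSumFinEquiv.symm (Fin.cast h.symm j) <;> rfl

theorem concat_map {A B : Type*} {m ℓ c : ℕ} (h : ℓ + c = m)
    (X : Matrix (Fin m) (Fin ℓ) A) (Y : Matrix (Fin m) (Fin c) A) (φ : A → B) :
    (concat h X Y).map φ = concat h (X.map φ) (Y.map φ) := by
  ext i j
  simp only [concat, of_apply, map_apply]
  cases finSumFinEquiv.symm (Fin.cast h.symm j) <;> rfl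

/-- If `1 = C * P + R₀ * J` with `J * C = 0`, then the determinant of `[C|Y]` is that of
`[C|R₀]` times the determinant of `J * Y`. -/
theorem det_concat_eq_mul {A : Type*} [CommRing A] {m ℓ c : ℕ} (h : ℓ + c = m)
    (C : Matrix (Fin m) (Fin ℓ) A) (R₀ Y : Matrix (Fin m) (Fin c) A)
    (P : Matrix (Fin ℓ) (Fin m) A) (J : Matrix (Fin c) (Fin m) A)
    (hP : C * P + R₀ * J = 1) :
    (concat h C Y).det = (concat h C R₀).det * (J * Y).det := by
  have key : fromCols C Y = fromCols C R₀ * fromBlocks 1 (P * Y) 0 (J * Y) := by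
    rw [fromCols_mul_fromBlocks]
    simp only [Matrix.mul_one, Matrix.mul_zero, add_zero, ← Matrix.mul_assoc]
    rw [← Matrix.add_mul, hP, Matrix.one_mul]
  rw [concat_eq_submatrix, concat_eq_submatrix, key,
    submatrix_mul _ _ id ((finCongr h.symm).trans finSumFinEquiv.symm) _ (Equiv.bijective _),
    det_mul, det_submatrix_equiv_self, det_fromBlocks_zero₂₁, det_one, one_mul]

theorem isUnit_det_concat {A : Type*} [CommRing A] {m ℓ c : ℕ} (h : ℓ + c = m)
    (C : Matrix (Fin m) (Fin ℓ) A) (R₀ : Matrix (Fin m) (Fin c) A)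
    (P : Matrix (Fin ℓ) (Fin m) A) (J : Matrix (Fin c) (Fin m) A)
    (hP : C * P + R₀ * J = 1) : IsUnit (concat h C R₀).det := by
  have key : concat h C R₀ *
      (fromRows P J).submatrix ((finCongr h.symm).trans finSumFinEquiv.symm) id = 1 := by
    rw [concat_eq_submatrix, ← submatrix_mul _ _ _ _ _ (Equiv.bijective _),
      fromCols_mul_fromRows, hP, submatrix_id_id]
  exact IsUnit.of_mul_eq_one _ (by rw [← det_mul, key, det_one])

theorem inc_comp (A : Type*) [Ring A] {m k n' : ℕ} (s t : Fin m → Fin (n' + 1))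
    (f : Fin k → Fin m) :
    inc A k n' (s ∘ f) (t ∘ f) = (inc A m n' s t).submatrix f id := rfl

/-- A path from `x` to `y` has an incidence vector with boundary `y - x`. -/
theorem exists_boundary_eq {m n' : ℕ} {s t : Fin m → Fin (n' + 1)} {T : Set (Fin m)}
    {x y : Fin (n' + 1)} (h : Conn m (n' + 1) s t T x y) :
    ∃ z : Fin m → ℤ, ∀ j, ((inc ℤ m n' s t)ᵀ *ᵥ z) j =
      (if y = Fin.castSucc j then 1 else 0) - (if x = Fin.castSucc j then 1 else 0) := by
  unfold Conn at h
  induction h with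
  | refl => exact ⟨0, by simp⟩
  | tail _ hstep ih =>
    obtain ⟨z, hz⟩ := ih
    obtain ⟨e, -, ⟨rfl, rfl⟩ | ⟨rfl, rfl⟩⟩ := hstep
    · refine ⟨z + Pi.single e 1, fun j => ?_⟩
      rw [mulVec_add, Pi.add_apply, hz, mulVec_single_one]
      simp only [col_apply, transpose_apply, inc, of_apply]
      ring
    · refine ⟨z - Pi.single e 1, fun j => ?_⟩
      rw [mulVec_sub, Pi.sub_apply, hz, mulVec_single_one]
      simp only [col_apply, transpose_apply, inc, of_apply]
      ring

/-- The transposed reduced incidence matrix of a connected graph has an integral right inverse. -/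
theorem IsConnectedGraph.exists_right_inverse {m n' : ℕ} {s t : Fin m → Fin (n' + 1)}
    (h : IsConnectedGraph m (n' + 1) s t) :
    ∃ R₀ : Matrix (Fin m) (Fin n') ℤ, (inc ℤ m n' s t)ᵀ * R₀ = 1 := by
  choose z hz using fun v : Fin n' => exists_boundary_eq (h (Fin.last n') v.castSucc)
  refine ⟨(of z)ᵀ, ?_⟩
  ext j v
  have := hz v j
  rw [if_neg (Fin.castSucc_lt_last j).ne'] at this
  simp only [Fin.castSucc_inj, sub_zero] at this
  rw [one_apply, mul_apply]
  simpa [mulVec, dotProduct, eq_comm] using this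

/-- The square reduced incidence matrix of a disconnected graph is singular. -/
theorem det_inc_eq_zero {n' : ℕ} {s t : Fin n' → Fin (n' + 1)}
    (h : ¬ IsConnectedGraph n' (n' + 1) s t) : (inc ℤ n' n' s t).det = 0 := by
  classical
  obtain ⟨x, hx⟩ : ∃ x, ¬ Conn n' (n' + 1) s t Set.univ x (Fin.last n') := by
    by_contra! hall
    exact h fun x y => (hall x).trans (hall y).symm
  have hne : x ≠ Fin.last n' := by
    rintro rfl
    exact hx Relation.ReflTransGen.refl
  obtain ⟨v, rfl⟩ := Fin.exists_castSucc_eq.mpr hne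
  let ind : Fin (n' + 1) → ℤ :=
    fun y => if Conn n' (n' + 1) s t Set.univ v.castSucc y then 1 else 0
  refine exists_mulVec_eq_zero_iff.mp ⟨fun j => ind j.castSucc, fun h0 => ?_, ?_⟩
  · have := congrFun h0 v
    simp [ind, Conn, Relation.ReflTransGen.refl] at this
  · have hsum : ∀ y, ∑ j : Fin n', (if y = j.castSucc then (1 : ℤ) else 0) * ind j.castSucc
        = ind y := by
      intro y
      have := Fin.sum_univ_castSucc fun j => (if y = j then (1 : ℤ) else 0) * ind j
      have hlast : ind (Fin.last n') = 0 := if_neg hx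
      rw [hlast, mul_zero, add_zero] at this
      rw [← this]
      simp only [ite_mul, one_mul, zero_mul, Finset.sum_ite_eq, Finset.mem_univ, if_true]
    have hst : ∀ e, ind (t e) = ind (s e) := fun e => by
      have hiff : Conn n' (n' + 1) s t Set.univ v.castSucc (t e) ↔
          Conn n' (n' + 1) s t Set.univ v.castSucc (s e) :=
        ⟨fun h => h.tail ⟨e, trivial, Or.inr ⟨rfl, rfl⟩⟩,
          fun h => h.tail ⟨e, trivial, Or.inl ⟨rfl, rfl⟩⟩⟩
      simp only [ind, hiff]
    ext e
    simp only [mulVec, dotProduct, inc, of_apply, sub_mul, Finset.sum_sub_distrib, hsum, hst,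
      sub_self, Pi.zero_apply]

open Classical in
theorem det_inc_mul_self {n' : ℕ} (s t : Fin n' → Fin (n' + 1)) :
    (inc ℤ n' n' s t).det * (inc ℤ n' n' s t).det =
      if IsConnectedGraph n' (n' + 1) s t then 1 else 0 := by
  split_ifs with h
  · obtain ⟨R₀, hR₀⟩ := h.exists_right_inverse
    have hu : IsUnit (inc ℤ n' n' s t).det := by
      rw [← det_transpose]
      exact IsUnit.of_mul_eq_one _ (by rw [← det_mul, hR₀, det_one])
    exact Int.isUnit_mul_self hu
  · rw [det_inc_eq_zero h, zero_mul]

theorem isConnectedGraph_comp_iff {m k n : ℕ} (s t : Fin m → Fin n) (f : Fin k → Fin m) :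
    IsConnectedGraph k n (s ∘ f) (t ∘ f) ↔ ∀ x y, Conn m n s t (Set.range f) x y := by
  simp [IsConnectedGraph, Conn]

theorem det_transpose_mul_eq_sum {A m n : Type*} [CommRing A] [Fintype m] [Fintype n]
    [DecidableEq n] (X Y : Matrix m n A) :
    (Xᵀ * Y).det = ∑ f : n → m, (∏ i, X (f i) i) * (Y.submatrix f id).det := by
  classical
  have hrow : Xᵀ * Y = fun i => ∑ e, X e i • Y e := by
    ext i j
    simp [mul_apply]
  have := (detRowAlternating (n := n) (R := A)).toMultilinearMap.map_sum
    (fun i e => X e i • Y e)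
  rw [hrow]
  refine this.trans (Finset.sum_congr rfl fun f _ => ?_)
  exact MultilinearMap.map_smul_univ _ _ _

/-- The Cauchy–Binet formula. -/
theorem det_transpose_mul_eq_sum_powersetCard {A : Type*} [CommRing A] {m k : ℕ}
    (X Y : Matrix (Fin m) (Fin k) A) :
    (Xᵀ * Y).det = ∑ S : {S : Finset (Fin m) // S.card = k},
      (X.submatrix (S.1.orderEmbOfFin S.2) id).det *
        (Y.submatrix (S.1.orderEmbOfFin S.2) id).det := by
  classical
  have hfib : ∀ S : {S : Finset (Fin m) // S.card = k},
      (X.submatrix (S.1.orderEmbOfFin S.2) id).det *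
        (Y.submatrix (S.1.orderEmbOfFin S.2) id).det =
      ∑ σ : Equiv.Perm (Fin k), (∏ i, X (S.1.orderEmbOfFin S.2 (σ i)) i) *
        (Y.submatrix (S.1.orderEmbOfFin S.2 ∘ σ) id).det := by
    intro S
    rw [det_apply', Finset.sum_mul]
    refine Finset.sum_congr rfl fun σ _ => ?_
    have hperm : (Y.submatrix (S.1.orderEmbOfFin S.2 ∘ σ) id).det =
        Equiv.Perm.sign σ * (Y.submatrix (S.1.orderEmbOfFin S.2) id).det :=
      det_permute σ (Y.submatrix (S.1.orderEmbOfFin S.2) id)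
    rw [hperm]
    simp only [submatrix_apply, id]
    ring
  simp only [hfib]
  rw [det_transpose_mul_eq_sum, ← Finset.sum_filter_add_sum_filter_not _ Function.Injective,
    Finset.sum_eq_zero (s := Finset.univ.filter fun f => ¬ Function.Injective f), add_zero,
    ← Finset.sum_product', Finset.univ_product_univ]
  · refine (Finset.sum_bij (fun p _ => p.1.1.orderEmbOfFin p.1.2 ∘ p.2) ?_ ?_ ?_ ?_).symm
    · rintro ⟨S, σ⟩ -
      simpa using (S.1.orderEmbOfFin S.2).injective
    · rintro ⟨⟨S, hS⟩, σ⟩ - ⟨⟨S', hS'⟩, σ'⟩ - heq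
      have hr := congrArg Set.range heq
      simp only [EquivLike.range_comp, Finset.range_orderEmbOfFin, Finset.coe_inj] at hr
      subst hr
      congr 1
      ext i : 1
      exact (S.orderEmbOfFin hS).injective (congrFun heq i)
    · intro f hf
      have hinj : Function.Injective f := by simpa using hf
      have hc : (Finset.univ.image f).card = k := by
        simp [Finset.card_image_of_injective _ hinj]
      have hmem : ∀ i, ∃ j, (Finset.univ.image f).orderEmbOfFin hc j = f i := fun i => by
        rw [← Set.mem_range, Finset.range_orderEmbOfFin]
        simp
      choose g hg using hmem
      have hgi : Function.Injective g := fun a b hab => hinj (by rw [← hg, ← hg, hab])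
      exact ⟨⟨⟨_, hc⟩, Equiv.ofBijective g (Finite.injective_iff_bijective.mp hgi)⟩,
        Finset.mem_univ _, funext hg⟩
    · intro p _
      rfl
  · intro f hf
    simp only [Finset.mem_filter, Finset.mem_univ, true_and, Function.Injective,
      not_forall] at hf
    obtain ⟨i, j, hij, hne⟩ := hf
    rw [det_zero_of_row_eq hne, mul_zero]
    ext l
    simp [hij]

/-- The matrix-tree theorem. -/
theorem det_inc_transpose_mul_inc (m n' : ℕ) (s t : Fin m → Fin (n' + 1)) :
    ((inc ℤ m n' s t)ᵀ * inc ℤ m n' s t).det = treeCount m n' s t := by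
  classical
  rw [det_transpose_mul_eq_sum_powersetCard]
  have hterm : ∀ S : {S : Finset (Fin m) // S.card = n'},
      ((inc ℤ m n' s t).submatrix (S.1.orderEmbOfFin S.2) id).det *
        ((inc ℤ m n' s t).submatrix (S.1.orderEmbOfFin S.2) id).det =
      if IsSpanningTree m (n' + 1) s t S.1 then 1 else 0 := by
    intro S
    rw [← inc_comp, det_inc_mul_self]
    simp only [isConnectedGraph_comp_iff, Finset.range_orderEmbOfFin, IsSpanningTree, S.2,
      Nat.add_sub_cancel, true_and]
  simp only [hterm]
  rw [← Finset.sum_subtype (Finset.univ.filter fun S : Finset (Fin m) => S.card = n')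
    (by simp) fun S => if IsSpanningTree m (n' + 1) s t S then (1 : ℤ) else 0]
  rw [Finset.sum_boole, Finset.filter_filter, treeCount]
  congr 2
  ext S
  simp only [Finset.mem_filter, Finset.mem_univ, true_and, and_iff_right_iff_imp]
  exact fun h => h.1

/-- A right inverse of the transposed incidence matrix splits the cycle lattice. -/
theorem IsCycleMatrix.exists_splitting {m n' ℓ : ℕ} {s t : Fin m → Fin (n' + 1)}
    {C : Matrix (Fin m) (Fin ℓ) ℤ} (hC : IsCycleMatrix m n' ℓ s t C)
    {R₀ : Matrix (Fin m) (Fin n') ℤ} (hR₀ : (inc ℤ m n' s t)ᵀ * R₀ = 1) :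
    ∃ P : Matrix (Fin ℓ) (Fin m) ℤ, C * P + R₀ * (inc ℤ m n' s t)ᵀ = 1 := by
  have hker : (inc ℤ m n' s t)ᵀ * (1 - R₀ * (inc ℤ m n' s t)ᵀ) = 0 := by
    rw [Matrix.mul_sub, ← Matrix.mul_assoc, hR₀, Matrix.mul_one, Matrix.one_mul, sub_self]
  choose p hp using fun e : Fin m =>
    (hC.2 ((1 - R₀ * (inc ℤ m n' s t)ᵀ).col e) (by
      ext j
      exact congrFun (congrFun hker j) e)).exists
  refine ⟨(of p)ᵀ, ?_⟩
  rw [← eq_sub_iff_add_eq]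
  ext i e
  exact congrFun (hp e) i

/-- **Spanning tree count from concatenated determinants.** -/
theorem det_concat_counts_trees (m n' ℓ : ℕ) (s t : Fin m → Fin (n' + 1))
    (hconn : IsConnectedGraph m (n' + 1) s t) (hm : ℓ + n' = m)
    (C : Matrix (Fin m) (Fin ℓ) ℤ) (hC : IsCycleMatrix m n' ℓ s t C)
    (R : Matrix (Fin m) (Fin n') ℝ) (hR : Rᵀ * inc ℝ m n' s t = 1) :
    ((concat hm C (inc ℤ m n' s t)).det : ℝ) =
      (concat hm (C.map (Int.cast : ℤ → ℝ)) R).det * (treeCount m n' s t : ℝ) ∧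
    ((concat hm (C.map (Int.cast : ℤ → ℝ)) R).det = 1 ∨
      (concat hm (C.map (Int.cast : ℤ → ℝ)) R).det = -1) := by
  obtain ⟨R₀, hR₀⟩ := hconn.exists_right_inverse
  obtain ⟨P, hP⟩ := hC.exists_splitting hR₀
  have hPℝ : C.map (Int.cast : ℤ → ℝ) * P.map (Int.cast : ℤ → ℝ) +
      R₀.map (Int.cast : ℤ → ℝ) * (inc ℝ m n' s t)ᵀ = 1 := by
    have h := congrArg (fun M => M.map (Int.castRingHom ℝ)) hP
    simp only [Matrix.map_add _ (map_add (Int.castRingHom ℝ)), Matrix.map_mul,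
      Matrix.map_one _ (map_zero (Int.castRingHom ℝ)) (map_one (Int.castRingHom ℝ))] at h
    rw [← inc_map_intCast]
    exact h
  have hR' : (inc ℝ m n' s t)ᵀ * R = 1 := by
    simpa using congrArg transpose hR
  have hdet : (concat hm (C.map (Int.cast : ℤ → ℝ)) R).det = ((concat hm C R₀).det : ℝ) := by
    rw [det_concat_eq_mul hm _ _ R _ _ hPℝ, hR', det_one, mul_one, ← concat_map]
    exact (RingHom.map_det (Int.castRingHom ℝ) _).symm
  rw [hdet]
  constructor
  · rw [det_concat_eq_mul hm C R₀ _ P _ hP, det_inc_transpose_mul_inc]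
    push_cast
    rfl
  · exact_mod_cast Int.isUnit_iff.mp (isUnit_det_concat hm C R₀ P _ hP)
end GraphForms
end

section
/- Spanning-tree expansion of Dodgson polynomials. Let G be a graph with positive Schwinger parameters and let A, B ⊆ E be sets of edges with |A| = |B|. Let 𝒰 be the collection of subsets U ⊆ E ∖ (A ∪ B) with |U| = ℓ − |A|. Then ψ^{A,B} = ∑_{U ∈ 𝒰} (−1)^{∑_{e ∈ U}(|A_{<e}| − |B_{<e}|)} · det(𝕀_{∖(U∪A)}) · det(𝕀_{∖(U∪B)}) · ∏_{e_i ∈ U} a_i, where A_{<e} := {a ∈ A : a < e} in the edge order, B_{<e} := {b ∈ B : b < e}, and for S ⊆ E with |S| = ℓ the matrix 𝕀_{∖S} is the (n−1) × (n−1) matrix obtained from 𝕀 by deleting the rows indexed by S. -/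
open Matrix BigOperators

namespace GraphForms

section Minors

open Finset

variable {α R : Type*} [LinearOrder α] [CommRing R]

/-- The increasing enumeration of `S` with one element skipped enumerates `S` minus that element. -/
theorem orderEmbOfFin_comp_succAbove {k : ℕ} (S : Finset α) (hS : S.card = k + 1)
    (i : Fin (k + 1)) (h : (S.erase (S.orderEmbOfFin hS i)).card = k) :
    S.orderEmbOfFin hS ∘ i.succAbove = (S.erase (S.orderEmbOfFin hS i)).orderEmbOfFin h := by
  refine orderEmbOfFin_unique h (fun x => ?_)
    ((S.orderEmbOfFin hS).strictMono.comp (Fin.strictMono_succAbove i))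
  simp [Fin.succAbove_ne]

/-- The position of an element of `S` in increasing order is the number of smaller elements. -/
theorem card_filter_lt_orderEmbOfFin {k : ℕ} (S : Finset α) (hS : S.card = k) (i : Fin k) :
    (S.filter (· < S.orderEmbOfFin hS i)).card = i := by
  have : S.filter (· < S.orderEmbOfFin hS i) =
      (Finset.Iio i).map (S.orderEmbOfFin hS).toEmbedding := by
    ext x
    constructor
    · intro hx
      obtain ⟨hxS, hlt⟩ := Finset.mem_filter.1 hx
      obtain ⟨j, rfl⟩ : x ∈ Set.range (S.orderEmbOfFin hS) := by simpa using hxS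
      simpa using hlt
    · simp only [Finset.mem_map, Finset.mem_filter]
      rintro ⟨j, hj, rfl⟩
      simpa using hj
  rw [this, Finset.card_map, Fin.card_Iio]

/-- A minor is affine in each entry of the matrix. -/
theorem det_submatrix_add_single {k : ℕ} (M : Matrix α α R) (S T : Finset α)
    (hS : S.card = k + 1) (hT : T.card = k + 1) {p q : α} (hp : p ∈ S) (hq : q ∈ T) (c : R)
    (hS' : (S.erase p).card = k) (hT' : (T.erase q).card = k) :
    ((M + Matrix.single p q c).submatrix (S.orderEmbOfFin hS) (T.orderEmbOfFin hT)).det =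
      (M.submatrix (S.orderEmbOfFin hS) (T.orderEmbOfFin hT)).det +
        (-1) ^ ((S.filter (· < p)).card + (T.filter (· < q)).card) * c *
          (M.submatrix ((S.erase p).orderEmbOfFin hS') ((T.erase q).orderEmbOfFin hT')).det := by
  obtain ⟨i, rfl⟩ : p ∈ Set.range (S.orderEmbOfFin hS) := by simpa using hp
  obtain ⟨j, rfl⟩ : q ∈ Set.range (T.orderEmbOfFin hT) := by simpa using hq
  set N := M.submatrix (S.orderEmbOfFin hS) (T.orderEmbOfFin hT) with hN
  have hupd : (M + Matrix.single (S.orderEmbOfFin hS i) (T.orderEmbOfFin hT j) c).submatrix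
      (S.orderEmbOfFin hS) (T.orderEmbOfFin hT) =
      N.updateRow i (N i + c • Pi.single j 1) := by
    ext x y
    by_cases hx : x = i
    · subst hx
      by_cases hy : y = j
      · subst hy; simp [hN]
      · simp [hN, hy, Ne.symm hy]
    · simp [hN, hx, Ne.symm hx]
  rw [hupd, Matrix.det_updateRow_add, Matrix.det_updateRow_smul, Matrix.updateRow_eq_self,
    ← Matrix.adjugate_apply, Matrix.adjugate_fin_succ_eq_det_submatrix,
    card_filter_lt_orderEmbOfFin, card_filter_lt_orderEmbOfFin,
    ← orderEmbOfFin_comp_succAbove, ← orderEmbOfFin_comp_succAbove, hN, Matrix.submatrix_submatrix]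
  ring

/-- The determinant of a block matrix with square blocks and zero diagonal blocks. -/
theorem det_fromBlocks_zero_zero {k : ℕ} (X Y : Matrix (Fin k) (Fin k) R) :
    (Matrix.fromBlocks 0 X (-Yᵀ) 0).det = X.det * Y.det := by
  let E : Matrix (Fin k) (Fin k) R := 1
  have h1 : Matrix.fromBlocks 0 X (-Yᵀ) 0 =
      Matrix.fromBlocks X 0 0 Yᵀ * Matrix.fromBlocks 0 E (-E) 0 := by
    simp [Matrix.fromBlocks_multiply, E]
  have h2 : (Matrix.fromBlocks 0 E (-E) 0).det = 1 := by
    have h3 : Matrix.fromBlocks 0 E (-E) 0 * Matrix.fromBlocks E (-E) 0 E =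
        Matrix.fromBlocks 0 E (-E) E := by
      simp [Matrix.fromBlocks_multiply, E]
    have h4 := congrArg Matrix.det h3
    rw [Matrix.det_mul, Matrix.det_fromBlocks_zero₂₁, Matrix.det_fromBlocks_one₂₂] at h4
    simpa [E] using h4
  rw [h1, Matrix.det_mul, h2, Matrix.det_fromBlocks_zero₂₁, Matrix.det_transpose, mul_one]

/-- A block matrix with zero diagonal blocks of different sizes is singular. -/
theorem det_fromBlocks_zero_zero_of_ne {p k : ℕ} (h : p ≠ k) (X : Matrix (Fin p) (Fin k) R)
    (Y : Matrix (Fin k) (Fin p) R) : (Matrix.fromBlocks 0 X Y 0).det = 0 := by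
  rw [Matrix.det_apply]
  refine Finset.sum_eq_zero fun σ _ => ?_
  rw [smul_eq_zero_iff_eq]
  by_contra hσ
  have hne : ∀ x, Matrix.fromBlocks 0 X Y 0 (σ x) x ≠ 0 := fun x hx =>
    hσ (Finset.prod_eq_zero (Finset.mem_univ x) hx)
  have hl : ∀ x : Fin p, ∃ y : Fin k, σ (Sum.inl x) = Sum.inr y := fun x => by
    have := hne (Sum.inl x)
    rcases hx : σ (Sum.inl x) with y | y <;> simp_all
  have hr : ∀ y : Fin k, ∃ x : Fin p, σ (Sum.inr y) = Sum.inl x := fun y => by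
    have := hne (Sum.inr y)
    rcases hy : σ (Sum.inr y) with x | x <;> simp_all
  choose f hf using hl
  choose g hg using hr
  have hfi : Function.Injective f := fun x y hxy =>
    Sum.inl_injective (σ.injective (by rw [hf, hf, hxy]))
  have hgi : Function.Injective g := fun x y hxy =>
    Sum.inr_injective (σ.injective (by rw [hg, hg, hxy]))
  exact h (le_antisymm (by simpa using Fintype.card_le_of_injective f hfi)
    (by simpa using Fintype.card_le_of_injective g hgi))

end Minors

section Dodgson

open Finset

variable {m n' : ℕ} {s t : Fin m → Fin (n' + 1)}

theorem edgeIdx_injective : Function.Injective (edgeIdx m n') :=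
  Fin.castAdd_injective m n'

theorem card_compl_image_edgeIdx (A : Finset (Fin m)) :
    ((A.image (edgeIdx m n'))ᶜ).card = Aᶜ.card + n' := by
  have := A.card_le_univ
  rw [Fintype.card_fin] at this
  rw [card_compl, card_compl, card_image_of_injective _ edgeIdx_injective, Fintype.card_fin,
    Fintype.card_fin]
  omega

theorem dodgson_eq_det_submatrix {k : ℕ} (a : Fin m → ℝ) (A B : Finset (Fin (m + n')))
    (hA : Aᶜ.card = k) (hB : Bᶜ.card = k) :
    dodgson m n' s t a A B =
      ((MM m n' s t a).submatrix (Aᶜ.orderEmbOfFin hA) (Bᶜ.orderEmbOfFin hB)).det := by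
  have hA' := A.card_add_card_compl
  have hB' := B.card_add_card_compl
  rw [Fintype.card_fin] at hA' hB'
  obtain rfl : k = m + n' - A.card := by omega
  rw [dodgson, dif_pos (by omega)]
  rfl

/-- Among the indices of `𝕄` below an edge, those outside `A` are counted by the position of the
edge corrected by the number of smaller elements of `A`. -/
theorem card_filter_lt_edgeIdx_add (A : Finset (Fin m)) (e : Fin m) :
    ((A.image (edgeIdx m n'))ᶜ.filter (· < edgeIdx m n' e)).card +
      (A.filter (· < e)).card = e := by
  have h1 : (A.filter (· < e)).card =
      ((A.image (edgeIdx m n')).filter (· < edgeIdx m n' e)).card := by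
    rw [filter_image, card_image_of_injective _ edgeIdx_injective]
    rfl
  rw [h1, add_comm, ← card_union_of_disjoint
    (disjoint_filter_filter disjoint_compl_right), ← filter_union, union_compl]
  have : (univ.filter (· < edgeIdx m n' e)) = Finset.Iio (edgeIdx m n' e) := by ext; simp
  rw [this, Fin.card_Iio]
  rfl

theorem MM_add_single (a : Fin m → ℝ) (e : Fin m) (c : ℝ) :
    MM m n' s t (a + Pi.single e c) =
      MM m n' s t a + Matrix.single (edgeIdx m n' e) (edgeIdx m n' e) c := by
  ext i j
  refine Fin.addCases (fun i => ?_) (fun i => ?_) i <;>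
    refine Fin.addCases (fun j => ?_) (fun j => ?_) j
  · by_cases hij : i = j
    · subst hij
      by_cases hi : i = e
      · subst hi; simp [MM, edgeIdx]
      · simp [MM, edgeIdx, hi, Ne.symm hi]
    · have : ¬ (e = i ∧ e = j) := fun h => hij (h.1.symm.trans h.2)
      simp [MM, edgeIdx, hij, this]
  all_goals
    simp [MM, edgeIdx, Matrix.single_apply, Fin.ext_iff]
    try omega

theorem dodgson_add_single (a : Fin m → ℝ) (e : Fin m) (c : ℝ) (A B : Finset (Fin m))
    (hAB : A.card = B.card) (heA : e ∉ A) (heB : e ∉ B) :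
    dodgson m n' s t (a + Pi.single e c) (A.image (edgeIdx m n')) (B.image (edgeIdx m n')) =
      dodgson m n' s t a (A.image (edgeIdx m n')) (B.image (edgeIdx m n')) +
        (-1) ^ (((A.filter (· < e)).card : ℤ) - ((B.filter (· < e)).card : ℤ)) * c *
          dodgson m n' s t a ((insert e A).image (edgeIdx m n'))
            ((insert e B).image (edgeIdx m n')) := by
  have hins (C : Finset (Fin m)) :
      ((insert e C).image (edgeIdx m n'))ᶜ = (C.image (edgeIdx m n'))ᶜ.erase (edgeIdx m n' e) := by
    rw [image_insert, compl_insert]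
  have hmem (C : Finset (Fin m)) (he : e ∉ C) :
      edgeIdx m n' e ∈ (C.image (edgeIdx m n'))ᶜ := by
    simpa [edgeIdx_injective.eq_iff] using he
  have hcard : ((A.image (edgeIdx m n'))ᶜ).card = ((B.image (edgeIdx m n'))ᶜ).card := by
    rw [card_compl_image_edgeIdx, card_compl_image_edgeIdx, card_compl, card_compl, hAB]
  obtain ⟨k, hk⟩ : ∃ k, ((A.image (edgeIdx m n'))ᶜ).card = k + 1 :=
    Nat.exists_eq_add_one.2 (card_pos.2 ⟨_, hmem A heA⟩)
  have hk' := hcard.symm.trans hk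
  have hA := card_erase_of_mem (hmem A heA)
  have hB := card_erase_of_mem (hmem B heB)
  rw [hk, Nat.add_sub_cancel] at hA
  rw [hk', Nat.add_sub_cancel] at hB
  have hpos := card_filter_lt_edgeIdx_add (n' := n') A e
  have hpos' := card_filter_lt_edgeIdx_add (n' := n') B e
  rw [dodgson_eq_det_submatrix _ _ _ hk hk', dodgson_eq_det_submatrix _ _ _ hk hk', MM_add_single,
    det_submatrix_add_single _ _ _ hk hk' (hmem A heA) (hmem B heB) c hA hB,
    dodgson_eq_det_submatrix (k := k) _ _ _ (by rw [hins, hA]) (by rw [hins, hB])]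
  simp only [hins]
  congr 3
  rw [← zpow_natCast]
  generalize (filter (· < edgeIdx m n' e) (A.image (edgeIdx m n'))ᶜ).card = x at *
  generalize (filter (· < edgeIdx m n' e) (B.image (edgeIdx m n'))ᶜ).card = y at *
  generalize (filter (· < e) A).card = u at *
  generalize (filter (· < e) B).card = v at *
  have : ((x + y : ℕ) : ℤ) = (u - v : ℤ) + 2 * x := by
    push_cast; omega
  rw [this, zpow_add₀ (by norm_num), (even_two_mul (x : ℤ)).neg_one_zpow, mul_one]

theorem dodgson_add_single_of_mem (a : Fin m → ℝ) (e : Fin m) (c : ℝ) (A B : Finset (Fin m))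
    (he : e ∈ A ∪ B) :
    dodgson m n' s t (a + Pi.single e c) (A.image (edgeIdx m n')) (B.image (edgeIdx m n')) =
      dodgson m n' s t a (A.image (edgeIdx m n')) (B.image (edgeIdx m n')) := by
  unfold dodgson
  split_ifs with h
  swap
  · rfl
  congr 1
  ext i j
  rw [Matrix.of_apply, Matrix.of_apply, MM_add_single, Matrix.add_apply,
    Matrix.single_apply_of_ne, add_zero]
  rintro ⟨hi, hj⟩
  have hi' := ((A.image (edgeIdx m n'))ᶜ.orderIsoOfFin (by simp [Finset.card_compl]) i).2
  have hj' := ((B.image (edgeIdx m n'))ᶜ.orderIsoOfFin (by simp [Finset.card_compl, h]) j).2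
  rw [← hi, mem_compl] at hi'
  rw [← hj, mem_compl] at hj'
  rcases mem_union.1 he with he | he
  · exact hi' (mem_image_of_mem _ he)
  · exact hj' (mem_image_of_mem _ he)

theorem orderEmbOfFin_compl_image_edgeIdx {p : ℕ} (A : Finset (Fin m)) (hA : Aᶜ.card = p)
    (h : ((A.image (edgeIdx m n'))ᶜ).card = p + n') :
    ((A.image (edgeIdx m n'))ᶜ.orderEmbOfFin h : Fin (p + n') → Fin (m + n')) =
      fun x => finSumFinEquiv (Sum.map (Aᶜ.orderEmbOfFin hA) id (finSumFinEquiv.symm x)) := by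
  symm
  refine orderEmbOfFin_unique h (fun x => ?_) (fun x y hxy => ?_)
  · refine Fin.addCases (fun i => ?_) (fun i => ?_) x
    · have := Aᶜ.orderEmbOfFin_mem hA i
      rw [mem_compl] at this
      simpa [edgeIdx] using this
    · simp [edgeIdx, Fin.ext_iff]
      omega
  · revert hxy
    refine Fin.addCases (fun i => ?_) (fun i => ?_) x <;>
      refine Fin.addCases (fun j => ?_) (fun j => ?_) y
    · simp [(Fin.strictMono_castAdd n').lt_iff_lt]
    · intro
      simp only [finSumFinEquiv_symm_apply_castAdd, finSumFinEquiv_symm_apply_natAdd,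
        Sum.map_inl, Sum.map_inr, finSumFinEquiv_apply_left, finSumFinEquiv_apply_right,
        Fin.lt_def, Fin.val_castAdd, Fin.val_natAdd]
      omega
    · intro hji
      rw [Fin.lt_def, Fin.val_castAdd, Fin.val_natAdd] at hji
      omega
    · simp

theorem dodgson_zero (A B : Finset (Fin m)) (hAB : A.card = B.card) :
    dodgson m n' s t 0 (A.image (edgeIdx m n')) (B.image (edgeIdx m n')) =
      if Aᶜ.card = n' then
        (rowSub (inc ℝ m n' s t) Aᶜ n').det * (rowSub (inc ℝ m n' s t) Bᶜ n').det
      else 0 := by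
  obtain ⟨p, hA⟩ : ∃ p, Aᶜ.card = p := ⟨_, rfl⟩
  have hB : Bᶜ.card = p := by rw [← hA, card_compl, card_compl, hAB]
  have hA' := card_compl_image_edgeIdx (n' := n') A
  have hB' := card_compl_image_edgeIdx (n' := n') B
  rw [hA] at hA'
  rw [hB] at hB'
  have hblock : (MM m n' s t 0).submatrix ((A.image (edgeIdx m n'))ᶜ.orderEmbOfFin hA')
      ((B.image (edgeIdx m n'))ᶜ.orderEmbOfFin hB') =
      (Matrix.fromBlocks 0 ((inc ℝ m n' s t).submatrix (Aᶜ.orderEmbOfFin hA) id)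
        (-((inc ℝ m n' s t).submatrix (Bᶜ.orderEmbOfFin hB) id)ᵀ) 0).submatrix
        finSumFinEquiv.symm finSumFinEquiv.symm := by
    rw [orderEmbOfFin_compl_image_edgeIdx A hA, orderEmbOfFin_compl_image_edgeIdx B hB]
    ext x y
    rcases hx : finSumFinEquiv.symm x with i | i <;> rcases hy : finSumFinEquiv.symm y with j | j <;>
      simp [MM, hx, hy]
  rw [dodgson_eq_det_submatrix _ _ _ hA' hB', hblock, Matrix.det_submatrix_equiv_self, hA]
  split_ifs with hp
  · subst hp
    rw [det_fromBlocks_zero_zero, rowSub, rowSub, dif_pos hA, dif_pos hB]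
    rfl
  · exact det_fromBlocks_zero_zero_of_ne hp _ _

/-- Expansion of a Dodgson polynomial in the parameters of the edges of `W`, all others being
set to zero. -/
theorem dodgson_piecewise_zero (a : Fin m → ℝ) (W : Finset (Fin m)) (A B : Finset (Fin m))
    (hAB : A.card = B.card) :
    dodgson m n' s t (W.piecewise a 0) (A.image (edgeIdx m n')) (B.image (edgeIdx m n')) =
      ∑ U ∈ (W \ (A ∪ B)).powerset,
        (-1 : ℝ) ^ (∑ e ∈ U, (((A.filter (· < e)).card : ℤ) - ((B.filter (· < e)).card : ℤ))) *
          (∏ e ∈ U, a e) *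
          dodgson m n' s t 0 ((U ∪ A).image (edgeIdx m n')) ((U ∪ B).image (edgeIdx m n')) := by
  induction W using Finset.induction_on generalizing A B with
  | empty => simp
  | insert e W he ih =>
    have hW : (insert e W).piecewise a 0 = W.piecewise a 0 + Pi.single e (a e) := by
      ext x
      by_cases hx : x = e
      · subst hx; simp [he]
      · by_cases hxW : x ∈ W <;> simp [hx, hxW]
    rw [hW]
    by_cases heAB : e ∈ A ∪ B
    · rw [dodgson_add_single_of_mem _ _ _ _ _ heAB, ih A B hAB, insert_sdiff_of_mem _ heAB]
    · have heA : e ∉ A := fun h => heAB (mem_union_left _ h)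
      have heB : e ∉ B := fun h => heAB (mem_union_right _ h)
      have hsd : W \ (insert e A ∪ insert e B) = W \ (A ∪ B) := by
        ext x
        simp only [mem_sdiff, mem_union, mem_insert]
        constructor
        · tauto
        · rintro ⟨hx, hn⟩
          have : x ≠ e := fun h => he (h ▸ hx)
          tauto
      have heU : ∀ U ∈ (W \ (A ∪ B)).powerset, e ∉ U := fun U hU h =>
        he (mem_sdiff.1 (mem_powerset.1 hU h)).1
      rw [dodgson_add_single _ _ _ _ _ hAB heA heB, ih A B hAB,
        ih (insert e A) (insert e B) (by simp [heA, heB, hAB]), hsd,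
        insert_sdiff_of_notMem _ heAB,
        sum_powerset_insert (fun h => he (mem_sdiff.1 h).1), mul_sum]
      congr 1
      refine sum_congr rfl fun U hU => ?_
      rw [sum_insert (heU U hU), prod_insert (heU U hU), zpow_add₀ (by norm_num)]
      have hsum : ∑ x ∈ U, ((((insert e A).filter (· < x)).card : ℤ) -
            (((insert e B).filter (· < x)).card : ℤ)) =
          ∑ x ∈ U, (((A.filter (· < x)).card : ℤ) - ((B.filter (· < x)).card : ℤ)) := by
        refine sum_congr rfl fun x _ => ?_
        rw [filter_insert, filter_insert]
        split_ifs <;> simp [heA, heB]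
      rw [hsum, union_insert, union_insert, insert_union, insert_union]
      ring

end Dodgson

/-- **Spanning-tree expansion of Dodgson polynomials.** -/
theorem dodgson_spanning_tree_expansion (m n' ℓ : ℕ) (s t : Fin m → Fin (n' + 1))
    (hm : ℓ + n' = m) (a : Fin m → ℝ) (ha : ∀ i, 0 < a i)
    (A B : Finset (Fin m)) (hAB : A.card = B.card) :
    dodgson m n' s t a (A.image (edgeIdx m n')) (B.image (edgeIdx m n')) =
      ∑ U ∈ Finset.univ.filter
          (fun U : Finset (Fin m) => U ⊆ (A ∪ B)ᶜ ∧ U.card + A.card = ℓ),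
        (-1 : ℝ) ^
            (∑ e ∈ U, (((A.filter (fun x => x < e)).card : ℤ) -
              ((B.filter (fun x => x < e)).card : ℤ))) *
          (rowSub (inc ℝ m n' s t) (U ∪ A)ᶜ n').det *
          (rowSub (inc ℝ m n' s t) (U ∪ B)ᶜ n').det *
          ∏ e ∈ U, a e := by
  have key := dodgson_piecewise_zero (n' := n') (s := s) (t := t) a Finset.univ A B hAB
  rw [Finset.piecewise_univ] at key
  rw [key]
  symm
  refine Finset.sum_subset_zero_on_sdiff (fun U hU => ?_) (fun U hU => ?_) (fun U hU => ?_)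
  · rw [Finset.mem_powerset, ← Finset.compl_eq_univ_sdiff]
    exact (Finset.mem_filter.1 hU).2.1
  all_goals
    have hsub : U ⊆ (A ∪ B)ᶜ := by
      simp only [Finset.mem_sdiff, Finset.mem_powerset, Finset.mem_filter,
        ← Finset.compl_eq_univ_sdiff] at hU
      tauto
    have hUA : Disjoint U A := Finset.disjoint_left.2 fun x hx hA =>
      Finset.mem_compl.1 (hsub hx) (Finset.mem_union_left _ hA)
    have hUB : Disjoint U B := Finset.disjoint_left.2 fun x hx hB =>
      Finset.mem_compl.1 (hsub hx) (Finset.mem_union_right _ hB)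
    have hcard := (U ∪ A).card_add_card_compl
    rw [Fintype.card_fin, Finset.card_union_of_disjoint hUA] at hcard
    rw [dodgson_zero _ _ (by
      rw [Finset.card_union_of_disjoint hUA, Finset.card_union_of_disjoint hUB, hAB])]
  · rw [if_neg, mul_zero]
    intro h
    refine (Finset.mem_sdiff.1 hU).2 (Finset.mem_filter.2 ⟨Finset.mem_univ _, hsub, ?_⟩)
    omega
  · have := (Finset.mem_filter.1 hU).2.2
    rw [if_pos (by omega)]
    ring
end GraphForms
end

section
/- Inverse Laplacian entries as Dodgson polynomials. Let G be a connected graph with positive Schwinger parameters and 𝒞 a cycle incidence matrix of G. Then for all 1 ≤ i, j ≤ n−1, (L⁻¹)_{v_i, v_j} = (−1)^{i+j} ψ^{v_i,v_j} / ψ_G, and for all 1 ≤ i, j ≤ m, (𝒞 Λ⁻¹ 𝒞ᵀ)_{e_i, e_j} = (−1)^{i+j} ψ^{e_i,e_j} / ψ_G. -/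
open Matrix BigOperators

namespace GraphForms

/-- A minor obtained by deleting one row and one column is a signed adjugate entry. -/
theorem det_compl_singleton {R : Type*} [CommRing R] {N k : ℕ} (M : Matrix (Fin N) (Fin N) R)
    (p q : Fin N) (hp : ({p}ᶜ : Finset (Fin N)).card = k)
    (hq : ({q}ᶜ : Finset (Fin N)).card = k) :
    Matrix.det (Matrix.of fun i j : Fin k =>
      M (({p}ᶜ : Finset (Fin N)).orderIsoOfFin hp i : Fin N)
        (({q}ᶜ : Finset (Fin N)).orderIsoOfFin hq j : Fin N)) =
      (-1) ^ ((p : ℕ) + q) * M.adjugate q p := by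
  cases N with
  | zero => exact p.elim0
  | succ N =>
    obtain rfl : N = k := by simpa [Finset.card_compl] using hp
    rw [Matrix.adjugate_fin_succ_eq_det_submatrix, ← mul_assoc, ← pow_add,
      Even.neg_one_pow (Even.add_self _), one_mul]
    congr 1
    ext i j
    simp

theorem dodgson_singleton {m n' : ℕ} (s t : Fin m → Fin (n' + 1)) (a : Fin m → ℝ)
    (p q : Fin (m + n')) :
    dodgson m n' s t a {p} {q} =
      (-1) ^ ((p : ℕ) + q) * (MM m n' s t a).adjugate q p := by
  rw [dodgson, dif_pos (by simp)]
  exact det_compl_singleton ..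

theorem neg_one_pow_mul_dodgson_div_psi {m n' : ℕ} (s t : Fin m → Fin (n' + 1))
    (a : Fin m → ℝ) (p q : Fin (m + n')) :
    (-1) ^ ((p : ℕ) + q) * dodgson m n' s t a {p} {q} / psi m n' s t a =
      (MM m n' s t a)⁻¹ q p := by
  rw [dodgson_singleton, ← mul_assoc, ← pow_add, Even.neg_one_pow (Even.add_self _), one_mul,
    Matrix.inv_def, Matrix.smul_apply, smul_eq_mul, Ring.inverse_eq_inv', psi, div_eq_inv_mul]

/-- The reduced incidence matrix of a connected graph has trivial kernel. -/
theorem inc_mulVec_injective {m n' : ℕ} {s t : Fin m → Fin (n' + 1)}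
    (hconn : IsConnectedGraph m (n' + 1) s t) :
    Function.Injective (inc ℝ m n' s t).mulVec := by
  refine (injective_iff_map_eq_zero (inc ℝ m n' s t).mulVecLin).mpr fun y hy => ?_
  set f : Fin (n' + 1) → ℝ := Fin.snoc (α := fun _ => ℝ) y 0 with hf
  have hdiff : ∀ e, (inc ℝ m n' s t).mulVec y e = f (t e) - f (s e) := by
    have hval : ∀ v, ∑ j, (if v = Fin.castSucc j then (1 : ℝ) else 0) * y j = f v := by
      intro v
      induction v using Fin.lastCases with
      | last => simp [hf, (Fin.castSucc_ne_last _).symm]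
      | cast i => simp [hf, Fin.castSucc_inj]
    intro e
    simp only [Matrix.mulVec, dotProduct, inc, Matrix.of_apply, sub_mul,
      Finset.sum_sub_distrib, hval]
  have hedge : ∀ e, f (t e) = f (s e) := fun e =>
    sub_eq_zero.mp ((hdiff e).symm.trans (congrFun hy e))
  have hconst : ∀ x z, Conn m (n' + 1) s t Set.univ x z → f x = f z := by
    intro x z h
    induction h with
    | refl => rfl
    | tail _ h ih =>
      obtain ⟨e, -, ⟨rfl, rfl⟩ | ⟨rfl, rfl⟩⟩ := h
      · exact ih.trans (hedge e).symm
      · exact ih.trans (hedge e)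
  ext j
  simpa [hf] using hconst _ _ (hconn (Fin.castSucc j) (Fin.last n'))

/-- An integer matrix with trivial kernel over `ℤ` has trivial kernel over `ℝ`. -/
theorem map_intCast_mulVec_injective {m k : Type*} [Fintype m] [Fintype k]
    {C : Matrix m k ℤ} (hC : Function.Injective C.mulVec) :
    Function.Injective (C.map (Int.cast : ℤ → ℝ)).mulVec := by
  classical
  have hdet : (Cᵀ * C).det ≠ 0 := by
    intro h
    obtain ⟨v, hv, hv'⟩ := Matrix.exists_mulVec_eq_zero_iff.mpr h
    refine hv (hC ?_)
    rw [Matrix.mulVec_zero, ← dotProduct_self_eq_zero, Matrix.dotProduct_mulVec,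
      ← Matrix.mulVec_transpose, Matrix.mulVec_mulVec, hv', zero_dotProduct]
  have hmap : (C.map (Int.cast : ℤ → ℝ))ᵀ * C.map (Int.cast : ℤ → ℝ) =
      (Int.castRingHom ℝ).mapMatrix (Cᵀ * C) :=
    (Matrix.map_mul (f := Int.castRingHom ℝ)).symm
  have hunit : IsUnit ((C.map (Int.cast : ℤ → ℝ))ᵀ * C.map (Int.cast : ℤ → ℝ)) := by
    rw [Matrix.isUnit_iff_isUnit_det, hmap, ← RingHom.map_det, isUnit_iff_ne_zero]
    exact Int.cast_ne_zero.mpr hdet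
  refine Function.Injective.of_comp (f := (C.map (Int.cast : ℤ → ℝ))ᵀ.mulVec) ?_
  simpa [Function.comp_def, Matrix.mulVec_mulVec] using
    Matrix.mulVec_injective_iff_isUnit.mpr hunit

theorem isUnit_transpose_mul_diagonal_mul {m k : Type*} [Fintype m] [Fintype k]
    [DecidableEq m] [DecidableEq k] {A : Matrix m k ℝ} (hA : Function.Injective A.mulVec)
    {d : m → ℝ} (hd : ∀ i, 0 < d i) : IsUnit (Aᵀ * Matrix.diagonal d * A) := by
  simpa [Matrix.conjTranspose_eq_transpose_of_trivial] using
    ((Matrix.PosDef.diagonal hd).conjTranspose_mul_mul_same hA).isUnit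

/-- If the columns of `C` and `J` are independent, satisfy `Jᵀ C = 0`, and are together as
many as the rows, then for `D = diag d` the matrices `C (Cᵀ D C)⁻¹ Cᵀ` and
`D⁻¹ J (Jᵀ D⁻¹ J)⁻¹ Jᵀ D⁻¹` add up to `D⁻¹`. -/
theorem mul_inv_mul_transpose_eq_sub {m k n : Type*} [Fintype m] [Fintype k] [Fintype n]
    [DecidableEq m] [DecidableEq k] [DecidableEq n] {C : Matrix m k ℝ} {J : Matrix m n ℝ}
    {d : m → ℝ} (hd : ∀ i, 0 < d i) (hC : Function.Injective C.mulVec)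
    (hJ : Function.Injective J.mulVec) (hJC : Jᵀ * C = 0)
    (hcard : Fintype.card k + Fintype.card n = Fintype.card m) :
    C * (Cᵀ * Matrix.diagonal d * C)⁻¹ * Cᵀ =
      Matrix.diagonal d⁻¹ - Matrix.diagonal d⁻¹ * J *
        (Jᵀ * Matrix.diagonal d⁻¹ * J)⁻¹ * Jᵀ * Matrix.diagonal d⁻¹ := by
  have hdd : Matrix.diagonal d⁻¹ * Matrix.diagonal d = 1 := by
    rw [Matrix.diagonal_mul_diagonal, ← Matrix.diagonal_one]
    exact congrArg _ (funext fun i => inv_mul_cancel₀ (hd i).ne')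
  have hΛ := isUnit_transpose_mul_diagonal_mul hC hd
  have hL := isUnit_transpose_mul_diagonal_mul hJ (d := d⁻¹) fun i => inv_pos.mpr (hd i)
  set D := Matrix.diagonal d
  set D' := Matrix.diagonal d⁻¹
  set Λ := Cᵀ * D * C with hΛdef
  set L := Jᵀ * D' * J with hLdef
  rw [Matrix.isUnit_iff_isUnit_det] at hΛ hL
  have hCJ : Cᵀ * J = 0 := by
    rw [← Matrix.transpose_transpose J, ← Matrix.transpose_mul, hJC, Matrix.transpose_zero]
  set Δ := C * Λ⁻¹ * Cᵀ - (D' - D' * J * L⁻¹ * Jᵀ * D') with hΔ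
  have hΔC : Δ * (D * C) = 0 := by
    have h1 : C * Λ⁻¹ * Cᵀ * (D * C) = C := by
      rw [Matrix.mul_assoc (C * Λ⁻¹), ← Matrix.mul_assoc Cᵀ, ← hΛdef,
        Matrix.nonsing_inv_mul_cancel_right _ _ hΛ]
    have h2 : D' * (D * C) = C := by rw [← Matrix.mul_assoc, hdd, Matrix.one_mul]
    have h3 : D' * J * L⁻¹ * Jᵀ * D' * (D * C) = 0 := by
      rw [Matrix.mul_assoc _ D', h2, Matrix.mul_assoc _ Jᵀ, hJC, Matrix.mul_zero]
    rw [hΔ, Matrix.sub_mul, Matrix.sub_mul, h1, h2, h3, sub_zero, sub_self]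
  have hΔJ : Δ * J = 0 := by
    have h1 : C * Λ⁻¹ * Cᵀ * J = 0 := by rw [Matrix.mul_assoc _ Cᵀ, hCJ, Matrix.mul_zero]
    have h2 : D' * J * L⁻¹ * Jᵀ * D' * J = D' * J := by
      rw [Matrix.mul_assoc (D' * J * L⁻¹ * Jᵀ), Matrix.mul_assoc (D' * J * L⁻¹),
        ← Matrix.mul_assoc Jᵀ, ← hLdef, Matrix.nonsing_inv_mul_cancel_right _ _ hL]
    rw [hΔ, Matrix.sub_mul, Matrix.sub_mul, h1, h2, sub_self, sub_zero]
  obtain ⟨e⟩ : Nonempty (m ≃ k ⊕ n) := Fintype.card_eq.mp (by simp [hcard])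
  set B : Matrix m m ℝ := (Matrix.fromCols (D * C) J).submatrix id e with hB
  have hBinj : Function.Injective B.mulVec := by
    refine (injective_iff_map_eq_zero B.mulVecLin).mpr fun x hx => ?_
    obtain ⟨w, rfl⟩ : ∃ w : k ⊕ n → ℝ, x = w ∘ e := ⟨x ∘ e.symm, by ext; simp⟩
    have hx' : (D * C).mulVec (w ∘ Sum.inl) + J.mulVec (w ∘ Sum.inr) = 0 := by
      rw [← Matrix.fromCols_mulVec]
      simpa [hB, Matrix.submatrix_mulVec_equiv, Function.comp_assoc] using hx
    have hk : w ∘ Sum.inl = 0 := by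
      refine Matrix.mulVec_injective_iff_isUnit.mpr
        ((Matrix.isUnit_iff_isUnit_det Λ).mpr hΛ) ?_
      have := congrArg Cᵀ.mulVec hx'
      rwa [Matrix.mulVec_add, Matrix.mulVec_mulVec, Matrix.mulVec_mulVec, hCJ,
        Matrix.zero_mulVec, add_zero, ← Matrix.mul_assoc, Matrix.mulVec_zero,
        ← Matrix.mulVec_zero Λ] at this
    have hn : w ∘ Sum.inr = 0 := by
      refine hJ ?_
      rwa [hk, Matrix.mulVec_zero, zero_add, ← Matrix.mulVec_zero J] at hx'
    have hw : w = 0 := by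
      ext (i | i)
      · exact congrFun hk i
      · exact congrFun hn i
    simp [hw]
  have hΔB : Δ * B = 0 := by
    have : Δ * B = (Δ * Matrix.fromCols (D * C) J).submatrix id e := by
      rw [hB, ← Matrix.submatrix_mul_equiv Δ _ id (Equiv.refl m) e]
      rfl
    rw [this, Matrix.mul_fromCols, hΔC, hΔJ, Matrix.fromCols_zero]
    rfl
  have hBunit := (Matrix.isUnit_iff_isUnit_det B).mp
    (Matrix.mulVec_injective_iff_isUnit.mp hBinj)
  have hzero : Δ = 0 := by
    rw [← Matrix.mul_nonsing_inv_cancel_right B Δ hBunit, hΔB, Matrix.zero_mul]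
  exact sub_eq_zero.mp hzero

/-- The blocks of the inverse of the expanded Laplacian, by Schur complement. -/
theorem fromBlocks_diagonal_inv {m n : Type*} [Fintype m] [Fintype n] [DecidableEq m]
    [DecidableEq n] {J : Matrix m n ℝ} {d : m → ℝ} (hd : ∀ i, 0 < d i)
    (hJ : Function.Injective J.mulVec) :
    (Matrix.fromBlocks (Matrix.diagonal d) J (-Jᵀ) 0)⁻¹ =
      Matrix.fromBlocks
        (Matrix.diagonal d⁻¹ - Matrix.diagonal d⁻¹ * J *
          (Jᵀ * Matrix.diagonal d⁻¹ * J)⁻¹ * Jᵀ * Matrix.diagonal d⁻¹)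
        (-(Matrix.diagonal d⁻¹ * J * (Jᵀ * Matrix.diagonal d⁻¹ * J)⁻¹))
        ((Jᵀ * Matrix.diagonal d⁻¹ * J)⁻¹ * Jᵀ * Matrix.diagonal d⁻¹)
        (Jᵀ * Matrix.diagonal d⁻¹ * J)⁻¹ := by
  have hdd : Matrix.diagonal d * Matrix.diagonal d⁻¹ = 1 := by
    rw [Matrix.diagonal_mul_diagonal, ← Matrix.diagonal_one]
    exact congrArg _ (funext fun i => mul_inv_cancel₀ (hd i).ne')
  have hL := isUnit_transpose_mul_diagonal_mul hJ (d := d⁻¹) fun i => inv_pos.mpr (hd i)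
  set D := Matrix.diagonal d
  set D' := Matrix.diagonal d⁻¹
  set L := Jᵀ * D' * J with hLdef
  rw [Matrix.isUnit_iff_isUnit_det] at hL
  have hDm (X : Matrix m m ℝ) : D * (D' * X) = X := by
    rw [← Matrix.mul_assoc, hdd, Matrix.one_mul]
  have hDn (X : Matrix m n ℝ) : D * (D' * X) = X := by
    rw [← Matrix.mul_assoc, hdd, Matrix.one_mul]
  have hLJ (X : Matrix n m ℝ) : Jᵀ * (D' * (J * (L⁻¹ * X))) = X := by
    rw [← Matrix.mul_assoc D', ← Matrix.mul_assoc Jᵀ, ← Matrix.mul_assoc Jᵀ, ← hLdef,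
      Matrix.mul_nonsing_inv_cancel_left _ _ hL]
  have hLJ' : Jᵀ * (D' * (J * L⁻¹)) = 1 := by
    rw [← Matrix.mul_assoc, ← Matrix.mul_assoc, ← hLdef, Matrix.mul_nonsing_inv _ hL]
  refine Matrix.inv_eq_right_inv ?_
  rw [Matrix.fromBlocks_multiply, ← Matrix.fromBlocks_one]
  congr 1 <;>
    simp [Matrix.mul_sub, Matrix.mul_assoc, hDm, hDn, hdd, hLJ, hLJ']

theorem MM_inv {m n' : ℕ} (s t : Fin m → Fin (n' + 1)) (a : Fin m → ℝ) :
    (MM m n' s t a)⁻¹ = (Matrix.fromBlocks (Matrix.diagonal a) (inc ℝ m n' s t)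
      (-(inc ℝ m n' s t)ᵀ) 0)⁻¹.submatrix finSumFinEquiv.symm finSumFinEquiv.symm :=
  Matrix.inv_submatrix_equiv _ _ _

/-- **Inverse Laplacian entries as Dodgson polynomials.** -/
theorem inverse_laplacian_dodgson (m n' ℓ : ℕ) (s t : Fin m → Fin (n' + 1))
    (hconn : IsConnectedGraph m (n' + 1) s t) (hm : ℓ + n' = m)
    (a : Fin m → ℝ) (ha : ∀ i, 0 < a i)
    (C : Matrix (Fin m) (Fin ℓ) ℤ) (hC : IsCycleMatrix m n' ℓ s t C) :
    (∀ i j : Fin n',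
      (vertexLap m n' s t a)⁻¹ i j =
        (-1 : ℝ) ^ (((i : ℕ) + 1) + ((j : ℕ) + 1)) * dodgV m n' s t a i j /
          psi m n' s t a) ∧
    (∀ i j : Fin m,
      (C.map (Int.cast : ℤ → ℝ) * (cycleLap a C)⁻¹ * (C.map (Int.cast : ℤ → ℝ))ᵀ) i j =
        (-1 : ℝ) ^ (((i : ℕ) + 1) + ((j : ℕ) + 1)) * dodgE m n' s t a i j /
          psi m n' s t a) := by
  have hJ := inc_mulVec_injective hconn
  have hCinj : Function.Injective C.mulVec := by
    intro x y hxy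
    obtain ⟨c, -, hc⟩ := hC.2 (C.mulVec y) (by
      rw [Matrix.mulVec_mulVec, hC.1, Matrix.zero_mulVec])
    exact (hc x hxy).trans (hc y rfl).symm
  have hJC : (inc ℝ m n' s t)ᵀ * C.map (Int.cast : ℤ → ℝ) = 0 := by
    have hinc : inc ℝ m n' s t = (inc ℤ m n' s t).map (Int.castRingHom ℝ) := by
      ext e j
      simp [inc]
    have h : ((inc ℤ m n' s t)ᵀ * C).map (Int.castRingHom ℝ) = 0 := by
      rw [hC.1, Matrix.map_zero _ (map_zero _)]
    rwa [Matrix.map_mul, Matrix.transpose_map, ← hinc] at h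
  have hMM := MM_inv s t a
  rw [fromBlocks_diagonal_inv ha hJ] at hMM
  have hL : vertexLap m n' s t a =
      (inc ℝ m n' s t)ᵀ * Matrix.diagonal a⁻¹ * inc ℝ m n' s t := rfl
  constructor
  · intro i j
    have hsymm : (vertexLap m n' s t a)ᵀ = vertexLap m n' s t a := by
      simp [vertexLap, Matrix.mul_assoc]
    have hsign : (-1 : ℝ) ^ ((i : ℕ) + 1 + (j + 1)) =
        (-1) ^ ((vtxIdx m n' i : ℕ) + vtxIdx m n' j) := by
      simp only [vtxIdx, Fin.val_natAdd]
      rw [show m + (i : ℕ) + (m + j) = 2 * m + (i + j) by ring,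
        show (i : ℕ) + 1 + (j + 1) = 2 * 1 + (i + j) by ring]
      simp [pow_add, pow_mul]
    rw [hsign, dodgV, neg_one_pow_mul_dodgson_div_psi, hMM]
    simp only [vtxIdx, Matrix.submatrix_apply, finSumFinEquiv_symm_apply_natAdd,
      Matrix.fromBlocks_apply₂₂]
    rw [← hL, ← Matrix.transpose_apply (vertexLap m n' s t a)⁻¹, Matrix.transpose_nonsing_inv,
      hsymm]
  · intro i j
    have hsymm : (cycleLap a C)ᵀ = cycleLap a C := by
      simp [cycleLap, Matrix.mul_assoc]
    have hsign : (-1 : ℝ) ^ ((i : ℕ) + 1 + (j + 1)) =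
        (-1) ^ ((edgeIdx m n' i : ℕ) + edgeIdx m n' j) := by
      simp only [edgeIdx, Fin.val_castAdd]
      rw [show (i : ℕ) + 1 + (j + 1) = 2 * 1 + (i + j) by ring]
      simp [pow_add]
    rw [hsign, dodgE, neg_one_pow_mul_dodgson_div_psi, hMM]
    simp only [edgeIdx, Matrix.submatrix_apply, finSumFinEquiv_symm_apply_castAdd,
      Matrix.fromBlocks_apply₁₁]
    rw [← mul_inv_mul_transpose_eq_sub ha (map_intCast_mulVec_injective hCinj) hJ hJC
      (by simpa using hm), ← cycleLap, ← Matrix.transpose_apply (_ * _ * _) i j]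
    simp only [Matrix.transpose_mul, Matrix.transpose_transpose, Matrix.transpose_nonsing_inv,
      hsymm, Matrix.mul_assoc]

end GraphForms
end
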